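/- arXiv:2411.17351 — 5 statements merged into one kernel-verified Lean document; each statement's English description precedes it below -/
import Mathlib

section
/- Let r ≥ 2, g ≥ 5, k ≥ 2 and s ≥ 1 be integers. Suppose there exists a finite simple r-regular graph of girth g on n_g vertices that contains s distinct vertices which are pairwise at distance at least ⌈g/2⌉ from each other. Then there exists a finite simple graph of girth exactly g, in which every vertex has degree r or degree rk and both degrees occur, whose number of vertices is exactly k·(n_g − s) + s. -/
theorem aux_egirth_le {V W : Type*} {G : SimpleGraph V} {H : SimpleGraph W} (f : G →g H)
    (hf : Function.Injective f) : H.egirth ≤ G.egirth := by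
  rw [SimpleGraph.le_egirth]
  intro a w hw
  have := SimpleGraph.le_egirth.1 (le_refl H.egirth) _ (w.map f)
    ((SimpleGraph.Walk.isCycle_map_iff_of_injective hf).2 hw)
  simpa using this

theorem aux_map_cycle {V W : Type*} {G : SimpleGraph V} {H : SimpleGraph W} (f : G →g H)
    {a b : V} (h : G.Adj a b) (p : G.Walk b a) (hc : (SimpleGraph.Walk.cons h p).IsCycle)
    (hinj : ∀ x ∈ p.support, ∀ y ∈ p.support, f x = f y → x = y) :
    ((SimpleGraph.Walk.cons h p).map f).IsCycle := by
  rw [SimpleGraph.Walk.map_cons, SimpleGraph.Walk.cons_isCycle_iff]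
  rw [SimpleGraph.Walk.cons_isCycle_iff] at hc
  obtain ⟨hp, he⟩ := hc
  constructor
  · rw [SimpleGraph.Walk.isPath_def, SimpleGraph.Walk.support_map]
    exact List.Nodup.map_on hinj hp.support_nodup
  · intro hm
    rw [SimpleGraph.Walk.edges_map, List.mem_map] at hm
    obtain ⟨e, hem, hee⟩ := hm
    induction e with | _ x y =>
    have hx := p.fst_mem_support_of_mem_edges hem
    have hy := p.snd_mem_support_of_mem_edges hem
    have ha := p.end_mem_support
    have hb := p.start_mem_support
    rw [Sym2.map_mk, Sym2.eq_iff] at hee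
    rcases hee with ⟨h1, h2⟩ | ⟨h1, h2⟩
    · obtain rfl := hinj _ hx _ ha h1
      obtain rfl := hinj _ hy _ hb h2
      exact he hem
    · obtain rfl := hinj _ hx _ hb h1
      obtain rfl := hinj _ hy _ ha h2
      exact he (Sym2.eq_swap ▸ hem)

abbrev AuxW {V : Type*} (S : Finset V) (k : ℕ) : Type _ :=
  {x : V × Fin k // x.1 ∈ S → (x.2 : ℕ) = 0}

def auxH {V : Type*} (G : SimpleGraph V) (S : Finset V) (k : ℕ) : SimpleGraph (AuxW S k) where
  Adj x y := G.Adj x.1.1 y.1.1 ∧ (x.1.1 ∈ S ∨ y.1.1 ∈ S ∨ x.1.2 = y.1.2)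
  symm := ⟨fun x y h => ⟨h.1.symm, by rcases h.2 with h | h | h <;> simp [h]⟩⟩
  loopless := ⟨fun x h => G.loopless.irrefl _ h.1⟩

def auxPi {V : Type*} (G : SimpleGraph V) (S : Finset V) (k : ℕ) : auxH G S k →g G where
  toFun x := x.1.1
  map_rel' h := h.1

theorem aux_path {V : Type*} (G : SimpleGraph V) (S : Finset V) (k : ℕ) {a b : AuxW S k}
    (p : (auxH G S k).Walk a b) (hp : p.IsPath) (hS : ∀ x ∈ p.support, x ≠ b → x.1.1 ∉ S) :
    ∃ i, ∀ x ∈ p.support, x.1.1 ∈ S ∨ x.1.2 = i := by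
  induction p with
  | nil => exact ⟨_, fun x hx => by simp at hx; right; rw [hx]⟩
  | @cons a c b h p ih =>
    rw [SimpleGraph.Walk.cons_isPath_iff] at hp
    have hab : a ≠ b := fun e => hp.2 (e ▸ p.end_mem_support)
    have ha : a.1.1 ∉ S := hS a (by simp) hab
    obtain ⟨i, hi⟩ := ih hp.1 (fun x hx => hS x (by simp [hx]))
    by_cases hc : c.1.1 ∈ S
    · have hcb : c = b := by
        by_contra hne
        exact hS c (by simp) hne hc
      subst hcb
      have : p = SimpleGraph.Walk.nil := by simpa using hp.1
      subst this
      refine ⟨a.1.2, fun x hx => ?_⟩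
      simp at hx
      rcases hx with rfl | rfl
      · right; rfl
      · left; exact hc
    · refine ⟨i, fun x hx => ?_⟩
      simp at hx
      rcases hx with rfl | hx
      · right
        have h1 := (hi c p.start_mem_support).resolve_left hc
        have h2 := (h.2.resolve_left ha).resolve_left hc
        rw [h2, h1]
      · exact hi x hx

theorem aux_lower {V : Type*} (G : SimpleGraph V) (S : Finset V) (k g : ℕ)
    (hgirth : G.egirth = g)
    (hSdist : ∀ u ∈ S, ∀ v ∈ S, u ≠ v → (((g + 1) / 2 : ℕ) : ℕ∞) ≤ G.edist u v) :
    (g : ℕ∞) ≤ (auxH G S k).egirth := by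
  classical
  have inj : ∀ x y : AuxW S k, x.1.1 = y.1.1 → (x.1.1 ∈ S ∨ x.1.2 = y.1.2) → x = y := by
    intro x y h1 h2
    apply Subtype.ext
    apply Prod.ext h1
    rcases h2 with h | h
    · exact Fin.ext ((x.2 h).trans (y.2 (h1 ▸ h)).symm)
    · exact h
  -- closed walk through unique S vertex at most
  have key : ∀ (a : AuxW S k) (w : (auxH G S k).Walk a a), w.IsCycle →
      (∀ x ∈ w.support, x ≠ a → x.1.1 ∉ S) → (g : ℕ∞) ≤ w.length := by
    intro a w hw hS
    cases w with
    | nil => simp at hw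
    | cons h p =>
      have hp := ((SimpleGraph.Walk.cons_isCycle_iff p h).1 hw).1
      obtain ⟨i, hi⟩ := aux_path G S k p hp (fun x hx => hS x (by simp [hx]))
      have hc := aux_map_cycle (auxPi G S k) h p hw (by
        intro x hx y hy hxy
        apply inj x y hxy
        rcases hi x hx with h1 | h1
        · exact Or.inl h1
        rcases hi y hy with h2 | h2
        · left; exact (show x.1.1 = y.1.1 from hxy) ▸ h2
        · right; rw [h1, h2])
      have := SimpleGraph.le_egirth.1 hgirth.ge _ _ hc
      simpa using this
  rw [SimpleGraph.le_egirth]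
  intro a w hw
  by_cases h : ∃ u ∈ w.support, u.1.1 ∈ S
  · obtain ⟨u, hu, huS⟩ := h
    have hlen : (w.rotate u hu).length = w.length := by simp
    rw [← hlen]
    by_cases h2 : ∀ x ∈ (w.rotate u hu).support, x ≠ u → x.1.1 ∉ S
    · exact key u _ (hw.rotate hu) h2
    · push Not at h2
      obtain ⟨v, hv, hne, hvS⟩ := h2
      generalize w.rotate u hu = q at hv
      have hne' : u.1.1 ≠ v.1.1 := fun e => hne (inj u v e (Or.inl huS)).symm
      have e1 := (hSdist _ huS _ hvS hne').trans
        (SimpleGraph.Walk.edist_le ((q.takeUntil v hv).map (auxPi G S k)))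
      have e2 := (hSdist _ hvS _ huS hne'.symm).trans
        (SimpleGraph.Walk.edist_le ((q.dropUntil v hv).map (auxPi G S k)))
      have e3 : (q.takeUntil v hv).length + (q.dropUntil v hv).length = q.length := by
        rw [← SimpleGraph.Walk.length_append, SimpleGraph.Walk.take_spec]
      rw [SimpleGraph.Walk.length_map] at e1 e2
      norm_cast at e1 e2 ⊢
      omega
  · push Not at h
    exact key a w hw (fun x hx _ => h x hx)

theorem aux_main {V : Type*} [Fintype V] (r g k s n : ℕ)
    (hr : 2 ≤ r) (hg : 5 ≤ g) (hk : 2 ≤ k) (hs : 1 ≤ s)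
    (G : SimpleGraph V) (hcard : Fintype.card V = n)
    (hreg : ∀ v : V, (G.neighborSet v).ncard = r)
    (hgirth : G.egirth = g)
    (S : Finset V) (hScard : S.card = s)
    (hSdist : ∀ u ∈ S, ∀ v ∈ S, u ≠ v → (((g + 1) / 2 : ℕ) : ℕ∞) ≤ G.edist u v) :
    (auxH G S k).egirth = g ∧
      (∀ w, ((auxH G S k).neighborSet w).ncard = r ∨ ((auxH G S k).neighborSet w).ncard = r * k) ∧
      (∃ w, ((auxH G S k).neighborSet w).ncard = r) ∧
      (∃ w, ((auxH G S k).neighborSet w).ncard = r * k) ∧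
      Nat.card (AuxW S k) = k * (n - s) + s := by
  classical
  have z : Fin k := ⟨0, by omega⟩
  have hind : ∀ u ∈ S, ∀ v ∈ S, ¬ G.Adj u v := by
    intro u hu v hv h
    have h1 := hSdist u hu v hv h.ne
    rw [SimpleGraph.edist_eq_one_iff_adj.2 h] at h1
    norm_cast at h1
    omega
  have hz : (⟨0, by omega⟩ : Fin k).val = 0 := rfl
  generalize hz0 : (⟨0, by omega⟩ : Fin k) = z0 at hz
  let c : Fin k → V → AuxW S k := fun i v =>
    ⟨(v, if v ∈ S then z0 else i), fun h => by simp only at h; simp [h, hz]⟩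
  have hcz : ∀ x : AuxW S k, x.1.1 ∈ S → x.1.2 = z0 := fun x h => Fin.ext ((x.2 h).trans hz.symm)
  have dN : ∀ w : AuxW S k, w.1.1 ∉ S → ((auxH G S k).neighborSet w).ncard = r := by
    intro w hw
    rw [← hreg w.1.1, ← Set.ncard_image_of_injective (f := c w.1.2) (G.neighborSet w.1.1)
      (fun x y h => congrArg (fun t : AuxW S k => t.1.1) h)]
    congr 1
    ext y
    constructor
    · intro h
      refine ⟨y.1.1, h.1, ?_⟩
      apply Subtype.ext
      refine Prod.ext (show (c w.1.2 y.1.1).1.1 = y.1.1 from rfl) ?_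
      by_cases hy : y.1.1 ∈ S
      · simp [c, hy, hcz y hy]
      · simpa [c, hy] using (h.2.resolve_left hw).resolve_left hy
    · rintro ⟨v, hv, rfl⟩
      refine ⟨hv, ?_⟩
      by_cases hy : v ∈ S
      · right; left; exact hy
      · right; right; simp [c, hy]
  have dS : ∀ w : AuxW S k, w.1.1 ∈ S → ((auxH G S k).neighborSet w).ncard = r * k := by
    intro w hw
    have e : Subtype.val '' ((auxH G S k).neighborSet w) = G.neighborSet w.1.1 ×ˢ Set.univ := by
      ext ⟨v, i⟩
      constructor
      · rintro ⟨⟨y, hy⟩, h, h'⟩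
        obtain rfl : y = (v, i) := h'
        exact ⟨h.1, trivial⟩
      · rintro ⟨h, -⟩
        exact ⟨⟨(v, i), fun hv => (hind _ hw _ hv h).elim⟩, ⟨h, Or.inl hw⟩, rfl⟩
    rw [← Set.ncard_image_of_injective _ Subtype.val_injective, e, Set.ncard_prod, hreg]
    simp
  obtain ⟨u, hu⟩ : S.Nonempty := Finset.card_pos.1 (by omega)
  obtain ⟨v, hv⟩ : (G.neighborSet u).Nonempty := by
    apply Set.nonempty_of_ncard_ne_zero
    rw [hreg]; omega
  refine ⟨le_antisymm ?_ (aux_lower G S k g hgirth hSdist), fun w => ?_,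
    ⟨c z0 v, dN _ fun h => hind u hu v h hv⟩, ⟨c z0 u, dS _ hu⟩, ?_⟩
  · rw [← hgirth]
    refine aux_egirth_le (⟨c z0, fun {x y} h => ⟨h, ?_⟩⟩ : G →g auxH G S k)
      (fun x y h => congrArg (fun t : AuxW S k => t.1.1) h)
    right; right; simp [c]
  · by_cases hw : w.1.1 ∈ S
    · exact Or.inr (dS w hw)
    · exact Or.inl (dN w hw)
  · have : Nat.card (AuxW S k) = (S ×ˢ {z0} ∪ Sᶜ ×ˢ Finset.univ : Finset (V × Fin k)).card := by
      rw [Nat.card_eq_fintype_card]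
      apply Fintype.card_of_subtype
      intro x
      have : x.2 = z0 ↔ (x.2 : ℕ) = 0 := by rw [Fin.ext_iff, hz]
      simp only [Finset.mem_union, Finset.mem_product, Finset.mem_singleton, Finset.mem_compl,
        Finset.mem_univ, this]
      tauto
    rw [this, Finset.card_union_of_disjoint]
    · simp [Finset.card_compl, hcard, hScard]; ring
    · rw [Finset.disjoint_left]
      rintro x hx hy
      simp only [Finset.mem_product, Finset.mem_compl] at hx hy
      exact hy.1 hx.1

/-- If there is a finite simple `r`-regular graph of girth `g ≥ 5` on `n` vertices
containing `s ≥ 1` distinct vertices pairwise at distance at least `⌈g/2⌉`, and `r ≥ 2`, `k ≥ 2`,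
then there is a finite simple graph of girth exactly `g` in which every vertex has degree `r` or
`r*k`, both degrees occur, and the number of vertices is exactly `k*(n - s) + s`. -/
theorem stmt_0 {V : Type*} [Fintype V] (r g k s n : ℕ)
    (hr : 2 ≤ r) (hg : 5 ≤ g) (hk : 2 ≤ k) (hs : 1 ≤ s)
    (G : SimpleGraph V) (hcard : Fintype.card V = n)
    (hreg : ∀ v : V, (G.neighborSet v).ncard = r)
    (hgirth : G.egirth = g)
    (S : Finset V) (hScard : S.card = s)
    (hSdist : ∀ u ∈ S, ∀ v ∈ S, u ≠ v → (((g + 1) / 2 : ℕ) : ℕ∞) ≤ G.edist u v) :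
    ∃ (W : Type) (_ : Finite W) (H : SimpleGraph W),
      H.egirth = g ∧
      (∀ w : W, (H.neighborSet w).ncard = r ∨ (H.neighborSet w).ncard = r * k) ∧
      (∃ w : W, (H.neighborSet w).ncard = r) ∧
      (∃ w : W, (H.neighborSet w).ncard = r * k) ∧
      Nat.card W = k * (n - s) + s := by

  obtain ⟨h1, h2, ⟨a, ha⟩, ⟨b, hb⟩, h5⟩ :=
    aux_main r g k s n hr hg hk hs G hcard hreg hgirth S hScard hSdist
  let e : AuxW S k ≃ Fin (Nat.card (AuxW S k)) := Finite.equivFin _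
  let φ : (auxH G S k).comap e.symm ≃g auxH G S k := SimpleGraph.Iso.comap e.symm _
  have hn : ∀ w, (((auxH G S k).comap e.symm).neighborSet w).ncard =
      ((auxH G S k).neighborSet (φ w)).ncard := fun w =>
    Set.ncard_congr' (φ.mapNeighborSet w)
  refine ⟨Fin (Nat.card (AuxW S k)), inferInstance, (auxH G S k).comap e.symm, ?_, ?_, ?_, ?_, ?_⟩
  · rw [← h1]
    exact le_antisymm (aux_egirth_le φ.symm.toHom φ.symm.injective)
      (aux_egirth_le φ.toHom φ.injective)
  · intro w
    rw [hn]
    exact h2 _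
  · exact ⟨φ.symm a, by rw [hn, φ.apply_symm_apply, ha]⟩
  · exact ⟨φ.symm b, by rw [hn, φ.apply_symm_apply, hb]⟩
  · rw [Nat.card_fin, h5]
end

section
/- Let r ≥ 2, g ≥ 5, k ≥ 1 be integers and let s ≥ 2 be an even integer. Suppose there exists a finite simple r-regular graph of girth g on n_g vertices that contains s distinct vertices which are pairwise at distance at least ⌈g/2⌉ from each other. Then there exists a finite simple graph of girth exactly g, in which every vertex has degree r or degree rk+1 and both degrees occur, whose number of vertices is exactly k·(n_g − s) + n_g + s. -/
namespace Cage

/-- `Rch A n u v`: there is an `A`-walk of length `n` from `u` to `v`. -/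
inductive Rch {V : Type*} (A : V → V → Prop) : ℕ → V → V → Prop
  | nil (u : V) : Rch A 0 u u
  | snoc {n : ℕ} {u v w : V} : Rch A n u v → A v w → Rch A (n + 1) u w

theorem Rch.trans {V : Type*} {A : V → V → Prop} {n m : ℕ} {u v w : V}
    (h : Rch A n u v) (h' : Rch A m v w) : Rch A (n + m) u w := by
  induction h' with
  | nil => exact h
  | snoc _ ha ih => exact Rch.snoc (ih h) ha

theorem Rch.single {V : Type*} {A : V → V → Prop} {u v : V} (h : A u v) : Rch A 1 u v :=
  Rch.snoc (Rch.nil u) h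

theorem Rch.symm {V : Type*} {A : V → V → Prop} (hA : ∀ p q, A p q → A q p) {n : ℕ} {u v : V}
    (h : Rch A n u v) : Rch A n v u := by
  induction h with
  | nil => exact Rch.nil _
  | snoc _ ha ih =>
    have := (Rch.single (hA _ _ ha)).trans ih
    rwa [Nat.add_comm] at this

theorem Rch.map {V W : Type*} {A : V → V → Prop} {B : W → W → Prop} (f : V → W)
    (hf : ∀ p q, A p q → B (f p) (f q)) {n : ℕ} {u v : V}
    (h : Rch A n u v) : Rch B n (f u) (f v) := by
  induction h with
  | nil => exact Rch.nil _
  | snoc _ ha ih => exact Rch.snoc ih (hf _ _ ha)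

theorem Rch.mono {V : Type*} {A B : V → V → Prop}
    (hf : ∀ p q, A p q → B p q) {n : ℕ} {u v : V}
    (h : Rch A n u v) : Rch B n u v := Rch.map id hf h

theorem Rch.eq_or_last {V : Type*} {A : V → V → Prop} {n : ℕ} {u v : V}
    (h : Rch A n u v) : u = v ∨ ∃ w, A w v := by
  cases h with
  | nil => exact Or.inl rfl
  | snoc _ ha => exact Or.inr ⟨_, ha⟩

theorem Rch.inv {V : Type*} {A : V → V → Prop} (P : ℕ → V → Prop) {u : V} (h0 : P 0 u)
    (hstep : ∀ n p q, P n p → A p q → P (n + 1) q) {n : ℕ} {v : V}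
    (h : Rch A n u v) : P n v := by
  induction h with
  | nil => exact h0
  | snoc _ ha ih => exact hstep _ _ _ (ih h0) ha

theorem rch_of_walk {V : Type*} {G : SimpleGraph V} {u v : V} (p : G.Walk u v) :
    Rch G.Adj p.length u v := by
  induction p with
  | nil => exact Rch.nil _
  | cons h p ih =>
    have := (Rch.single h).trans ih
    rwa [Nat.add_comm] at this

theorem walk_of_rch {V : Type*} {G : SimpleGraph V} {n : ℕ} {u v : V} (h : Rch G.Adj n u v) :
    ∃ p : G.Walk u v, p.length = n := by
  induction h with
  | nil => exact ⟨.nil, rfl⟩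
  | snoc _ ha ih =>
    obtain ⟨p, rfl⟩ := ih
    exact ⟨p.concat ha, by simp⟩

/-- Adjacency with the edge `xy` removed. -/
def Del {V : Type*} (A : V → V → Prop) (x y : V) : V → V → Prop :=
  fun p q => A p q ∧ s(p, q) ≠ s(x, y)

/-- A form of girth at least `g`. -/
def GirthGE {V : Type*} (A : V → V → Prop) (g : ℕ) : Prop :=
  ∀ x y, A x y → ∀ n, Rch (Del A x y) n x y → g ≤ n + 1

theorem girthGE_of_egirth {V : Type*} {G : SimpleGraph V} {g : ℕ} (h : (g : ℕ∞) ≤ G.egirth) :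
    GirthGE G.Adj g := by
  classical
  intro x y hxy n hn
  have hn' : Rch (G.deleteEdges {s(x, y)}).Adj n x y :=
    hn.mono (fun p q hpq => by
      rw [SimpleGraph.deleteEdges_adj]; exact ⟨hpq.1, by simpa using hpq.2⟩)
  obtain ⟨p, rfl⟩ := walk_of_rch hn'
  have hle : G.deleteEdges {s(x, y)} ≤ G := SimpleGraph.deleteEdges_le _
  let q : G.Walk x y := p.bypass.mapLe hle
  have hq : q.IsPath := (p.bypass_isPath).mapLe hle
  have hne : s(y, x) ∉ q.edges := by
    intro hmem
    have h2 : s(y, x) ∈ p.bypass.edges := by simpa [q] using hmem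
    have := SimpleGraph.Walk.edges_subset_edgeSet _ h2
    rw [SimpleGraph.edgeSet_deleteEdges] at this
    exact this.2 (by simp [Sym2.eq_swap])
  have hc : (SimpleGraph.Walk.cons hxy.symm q).IsCycle :=
    (SimpleGraph.Walk.cons_isCycle_iff _ _).2 ⟨hq, hne⟩
  have h3 := SimpleGraph.le_egirth.1 h _ _ hc
  have h4 : g ≤ q.length + 1 := by exact_mod_cast h3
  have h5 := p.length_bypass_le_length
  have h6 : q.length = p.bypass.length := by simp [q]
  omega

theorem rch_del_of_walk {V : Type*} {G : SimpleGraph V} {x y u v : V} (p : G.Walk u v)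
    (h : s(x, y) ∉ p.edges) : Rch (Del G.Adj x y) p.length u v := by
  induction p with
  | nil => exact Rch.nil _
  | cons ha p ih =>
    simp only [SimpleGraph.Walk.edges_cons, List.mem_cons, not_or] at h
    have := (Rch.single (A := Del G.Adj x y) ⟨ha, fun e => h.1 e.symm⟩).trans (ih h.2)
    rwa [Nat.add_comm] at this

theorem egirth_of_girthGE {V : Type*} {G : SimpleGraph V} {g : ℕ} (h : GirthGE G.Adj g) :
    (g : ℕ∞) ≤ G.egirth := by
  rw [SimpleGraph.le_egirth]
  intro a w hw
  cases w with
  | nil => exact absurd hw (by simp)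
  | cons ha p =>
    rw [SimpleGraph.Walk.cons_isCycle_iff] at hw
    have := h _ _ ha.symm _ (rch_del_of_walk p (by rw [Sym2.eq_swap]; exact hw.2))
    simp only [SimpleGraph.Walk.length_cons]
    exact_mod_cast this

/-- Pairwise distances on `T` are at least `c`. -/
def DistGE {V : Type*} (A : V → V → Prop) (T : Set V) (c : ℕ) : Prop :=
  ∀ u ∈ T, ∀ v ∈ T, u ≠ v → ∀ n, Rch A n u v → c ≤ n

theorem amalgam {W ι : Type*} (A : ι → W → W → Prop) (hsymm : ∀ i p q, A i p q → A i q p)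
    (T : Set W) (g c : ℕ) (hc : g ≤ 2 * c) (hgirth : ∀ i, GirthGE (A i) g)
    (hdist : ∀ i, DistGE (A i) T c)
    (hsep : ∀ i j, i ≠ j → ∀ p q q', A i p q → A j p q' → p ∈ T) :
    GirthGE (fun p q => ∃ i, A i p q) g := by
  rintro x y ⟨i, hxy⟩ n hn
  set D : ι → W → W → Prop := fun j => Del (A j) x y with hD
  have hDsymm : ∀ j p q, D j p q → D j q p := by
    rintro j p q ⟨h1, h2⟩
    exact ⟨hsymm _ _ _ h1, by rwa [Sym2.eq_swap]⟩
  have hDA : ∀ j p q, D j p q → A j p q := fun j p q h => h.1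
  have hDd : ∀ j, DistGE (D j) T c := fun j u hu v hv huv n h =>
    hdist j u hu v hv huv n (h.mono (hDA j))
  -- the end point of a walk in one piece that is continued in another piece lies in `T`
  have hmem : ∀ j l n u p q, Rch (D j) n u p → u ≠ p → A l p q → l ≠ j → p ∈ T := by
    intro j l n u p q h hne hq hlj
    rcases h.eq_or_last with h | ⟨w, hw⟩
    · exact absurd h hne
    · exact hsep j l (Ne.symm hlj) p w q (hsymm _ _ _ hw.1) hq
  have key := hn.inv (fun n w => (Rch (D i) n x w) ∨
      (∃ u ∈ T, ∃ j, ∃ a b, Rch (D i) a x u ∧ Rch (D j) b u w ∧ a + b ≤ n) ∨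
      (∃ u ∈ T, ∃ v ∈ T, ∃ j, ∃ a b, Rch (D i) a x u ∧ Rch (D j) b v w ∧ a + c + b ≤ n))
    (Or.inl (Rch.nil _)) (by
      rintro n p q hP ⟨⟨l, hl⟩, hne⟩
      have hDl : D l p q := ⟨hl, hne⟩
      rcases hP with h | ⟨u, hu, j, a, b, ha, hb, hab⟩ | ⟨u, hu, v, hv, j, a, b, ha, hb, hab⟩
      · by_cases hli : l = i
        · subst hli; exact Or.inl (h.snoc hDl)
        · have hp : p ∈ T := by
            by_cases hxp : x = p
            · subst hxp; exact hsep i l (Ne.symm hli) x y q hxy hl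
            · exact hmem i l _ _ _ _ h hxp hl hli
          exact Or.inr (Or.inl ⟨p, hp, l, n, 1, h, Rch.single hDl, le_rfl⟩)
      · by_cases hlj : l = j
        · subst hlj
          exact Or.inr (Or.inl ⟨u, hu, l, a, b + 1, ha, hb.snoc hDl, by omega⟩)
        · by_cases hup : u = p
          · subst hup
            exact Or.inr (Or.inl ⟨u, hu, l, a, 1, ha, Rch.single hDl, by omega⟩)
          · have hp := hmem j l _ _ _ _ hb hup hl hlj
            have := hDd j u hu p hp hup _ hb
            exact Or.inr (Or.inr ⟨u, hu, p, hp, l, a, 1, ha, Rch.single hDl, by omega⟩)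
      · have hp : l ≠ j → p ∈ T := by
          intro hlj
          by_cases hvp : v = p
          · exact hvp ▸ hv
          · exact hmem j l _ _ _ _ hb hvp hl hlj
        by_cases hlj : l = j
        · subst hlj
          exact Or.inr (Or.inr ⟨u, hu, v, hv, l, a, b + 1, ha, hb.snoc hDl, by omega⟩)
        · exact Or.inr (Or.inr ⟨u, hu, p, hp hlj, l, a, 1, ha, Rch.single hDl, by omega⟩))
  have hA : ∀ m, Rch (D i) m x y → g ≤ m + 1 := fun m h => hgirth i x y hxy m h
  -- from `y`, going through the removed edge and on to `u`
  have hB : ∀ v ∈ T, ∀ u ∈ T, u ≠ v → ∀ a b, Rch (D i) a x u → Rch (D i) b v y →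
      c ≤ a + b + 1 := by
    intro v hv u hu huv a b ha hb
    have h1 := (((hb.mono (hDA i)).snoc (hsymm _ _ _ hxy)).trans (ha.mono (hDA i)))
    have := hdist i v hv u hu (Ne.symm huv) _ h1
    omega
  have hy : ∀ j, j ≠ i → ∀ u ∈ T, ∀ b, Rch (D j) b u y → y ∈ T := by
    intro j hj u hu b hb
    by_cases huy : u = y
    · exact huy ▸ hu
    · exact hmem j i _ _ _ _ hb huy (hsymm _ _ _ hxy) (Ne.symm hj)
  rcases key with h | ⟨u, hu, j, a, b, ha, hb, hab⟩ | ⟨u, hu, v, hv, j, a, b, ha, hb, hab⟩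
  · exact hA _ h
  · by_cases hji : j = i
    · subst hji
      have := hA _ (ha.trans hb)
      omega
    · have hyT := hy j hji u hu b hb
      by_cases huy : u = y
      · subst huy
        have := hA _ ha
        omega
      · have h1 := hDd j u hu y hyT huy _ hb
        have h2 := hB y hyT u hu huy _ _ ha (Rch.nil _)
        omega
  · by_cases hji : j = i
    · subst hji
      by_cases huv : u = v
      · subst huv
        have := hA _ (ha.trans hb)
        omega
      · have := hB v hv u hu huv _ _ ha hb
        omega
    · have hyT := hy j hji v hv b hb
      by_cases huy : u = y
      · subst huy
        have := hA _ ha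
        omega
      · have h2 := hB y hyT u hu huy _ _ ha (Rch.nil _)
        omega


section Construction

variable {V : Type*} {t : ℕ}

/-- Vertices of the construction. -/
abbrev Vtx (σ : Fin t × Bool → V) (k : ℕ) : Type _ :=
  (Fin t × Bool) ⊕ ((Fin k × {v : V // v ∉ Set.range σ}) ⊕ V)

/-- The other end of a removed edge. -/
def flip (p : Fin t × Bool) : Fin t × Bool := (p.1, !p.2)

theorem flip_flip (p : Fin t × Bool) : flip (flip p) = p := by simp [flip]

theorem flip_ne (p : Fin t × Bool) : flip p ≠ p := by
  intro h
  have := congrArg Prod.snd h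
  simp [flip] at this

/-- Ends of removed edges. -/
def mm (σ : Fin t × Bool → V) (f : V → V) (p : Fin t × Bool) : V :=
  if p.2 then f (σ (p.1, false)) else σ (p.1, false)

/-- Extra copy with edges removed. -/
def Two (G : SimpleGraph V) (m : Fin t × Bool → V) (a b : V) : Prop :=
  G.Adj a b ∧ ∀ p, ¬ (a = m p ∧ b = m (flip p))

def proj (σ : Fin t × Bool → V) (k : ℕ) : Vtx σ k → V
  | .inl p => σ p
  | .inr (.inl x) => x.2.1
  | .inr (.inr v) => v

def InCp (σ : Fin t × Bool → V) (k : ℕ) (i : Fin k) : Vtx σ k → Prop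
  | .inl _ => True
  | .inr (.inl x) => x.1 = i
  | .inr (.inr _) => False

def LastAdj (σ : Fin t × Bool → V) (k : ℕ) (G : SimpleGraph V) (m : Fin t × Bool → V) :
    Vtx σ k → Vtx σ k → Prop
  | .inr (.inr a), .inr (.inr b) => Two G m a b
  | .inl p, .inr (.inr b) => b = m p
  | .inr (.inr b), .inl p => b = m p
  | _, _ => False

def Piece (σ : Fin t × Bool → V) (k : ℕ) (G : SimpleGraph V) (m : Fin t × Bool → V) :
    Option (Fin k) → Vtx σ k → Vtx σ k → Prop
  | some i => fun w w' => InCp σ k i w ∧ InCp σ k i w' ∧ G.Adj (proj σ k w) (proj σ k w')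
  | none => LastAdj σ k G m

theorem two_symm {G : SimpleGraph V} {m : Fin t × Bool → V} {a b : V} (h : Two G m a b) :
    Two G m b a :=
  ⟨h.1.symm, fun p hp => h.2 (flip p) ⟨hp.2, by rw [flip_flip]; exact hp.1⟩⟩

theorem piece_symm (σ : Fin t × Bool → V) (k : ℕ) (G : SimpleGraph V) (m : Fin t × Bool → V)
    (i : Option (Fin k)) (w w' : Vtx σ k) (h : Piece σ k G m i w w') : Piece σ k G m i w' w := by
  cases i with
  | some i => exact ⟨h.2.1, h.1, h.2.2.symm⟩
  | none =>
    rcases w with p | x | a <;> rcases w' with q | y | b <;>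
      simp only [Piece, LastAdj] at h ⊢ <;> first | exact h | exact two_symm h

theorem piece_irrefl (σ : Fin t × Bool → V) (k : ℕ) (G : SimpleGraph V) (m : Fin t × Bool → V)
    (i : Option (Fin k)) (w : Vtx σ k) : ¬ Piece σ k G m i w w := by
  intro h
  cases i with
  | some i => exact G.irrefl h.2.2
  | none =>
    rcases w with p | x | a <;> simp only [Piece, LastAdj] at h
    exact G.irrefl h.1

def Big (σ : Fin t × Bool → V) (k : ℕ) (G : SimpleGraph V) (m : Fin t × Bool → V) :
    SimpleGraph (Vtx σ k) where
  Adj w w' := ∃ i, Piece σ k G m i w w'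
  symm := ⟨fun w w' ⟨i, h⟩ => ⟨i, piece_symm σ k G m i w w' h⟩⟩
  loopless := ⟨fun w ⟨i, h⟩ => piece_irrefl σ k G m i w h⟩

theorem proj_inj {σ : Fin t × Bool → V} (hσ : Function.Injective σ) {k : ℕ} {i : Fin k}
    {w w' : Vtx σ k} (h : InCp σ k i w) (h' : InCp σ k i w')
    (e : proj σ k w = proj σ k w') : w = w' := by
  rcases w with p | ⟨j, v, hv⟩ | a <;> rcases w' with q | ⟨j', v', hv'⟩ | b <;>
    simp only [InCp, proj] at h h' e
  · rw [hσ e]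
  · exact absurd ⟨p, e⟩ hv'
  · exact absurd ⟨q, e.symm⟩ hv
  · subst h h' e; rfl

theorem girth_some {σ : Fin t × Bool → V} (hσ : Function.Injective σ) (k : ℕ)
    (G : SimpleGraph V) (m : Fin t × Bool → V) (g : ℕ) (hg : GirthGE G.Adj g) (i : Fin k) :
    GirthGE (Piece σ k G m (some i)) g := by
  intro x y hxy n hn
  refine hg _ _ hxy.2.2 n (hn.map (proj σ k) ?_)
  rintro p q ⟨h1, h2⟩
  refine ⟨h1.2.2, fun e => h2 ?_⟩
  rw [Sym2.eq_iff] at e ⊢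
  rcases e with ⟨e1, e2⟩ | ⟨e1, e2⟩
  · exact Or.inl ⟨proj_inj hσ h1.1 hxy.1 e1, proj_inj hσ h1.2.1 hxy.2.1 e2⟩
  · exact Or.inr ⟨proj_inj hσ h1.1 hxy.2.1 e1, proj_inj hσ h1.2.1 hxy.1 e2⟩

theorem dist_some {σ : Fin t × Bool → V} (hσ : Function.Injective σ) (k : ℕ)
    (G : SimpleGraph V) (m : Fin t × Bool → V) (c : ℕ) (hc : DistGE G.Adj (Set.range σ) c)
    (i : Fin k) : DistGE (Piece σ k G m (some i)) (Set.range Sum.inl) c := by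
  rintro _ ⟨p, rfl⟩ _ ⟨q, rfl⟩ hne n hn
  exact hc (σ p) ⟨p, rfl⟩ (σ q) ⟨q, rfl⟩ (fun e => hne (by rw [hσ e])) n
    (hn.map (proj σ k) (fun a b h => h.2.2))

theorem mm_far {σ : Fin t × Bool → V} (hσ : Function.Injective σ) {G : SimpleGraph V} {f : V → V}
    (hf : ∀ v, G.Adj v (f v)) {c : ℕ} (hc : DistGE G.Adj (Set.range σ) c)
    {p q : Fin t × Bool} (hpq : p.1 ≠ q.1) {n : ℕ} (hn : Rch G.Adj n (mm σ f p) (mm σ f q)) :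
    c ≤ n + 2 := by
  have key : ∀ p : Fin t × Bool, ∃ a, a ≤ 1 ∧ Rch G.Adj a (σ (p.1, false)) (mm σ f p) := by
    rintro ⟨i, b⟩
    cases b
    · exact ⟨0, by omega, by simpa [mm] using Rch.nil _⟩
    · exact ⟨1, le_rfl, by simpa [mm] using Rch.single (hf _)⟩
  obtain ⟨a, ha, hpa⟩ := key p
  obtain ⟨b, hb, hqb⟩ := key q
  have h := (hpa.trans hn).trans (hqb.symm (fun _ _ h => h.symm))
  have := hc (σ (p.1, false)) ⟨_, rfl⟩ (σ (q.1, false)) ⟨_, rfl⟩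
    (fun e => hpq (by
      have e2 := hσ e
      simpa using e2)) _ h
  omega

theorem eq_or_flip {p q : Fin t × Bool} (h : p.1 = q.1) : q = p ∨ q = flip p := by
  rcases p with ⟨i, b⟩
  rcases q with ⟨j, b'⟩
  simp only at h
  subst h
  cases b <;> cases b' <;> simp [flip]

theorem mm_adj {σ : Fin t × Bool → V} {G : SimpleGraph V} {f : V → V}
    (hf : ∀ v, G.Adj v (f v)) (p : Fin t × Bool) : G.Adj (mm σ f p) (mm σ f (flip p)) := by
  rcases p with ⟨i, b⟩
  cases b
  · simpa [mm, flip] using hf _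
  · simpa [mm, flip] using (hf _).symm

theorem mm_inj {σ : Fin t × Bool → V} (hσ : Function.Injective σ) {G : SimpleGraph V} {f : V → V}
    (hf : ∀ v, G.Adj v (f v)) {c : ℕ} (hc : DistGE G.Adj (Set.range σ) c) (hc3 : 3 ≤ c) :
    Function.Injective (mm σ f) := by
  intro p q h
  by_cases hpq : p.1 = q.1
  · rcases eq_or_flip hpq with e | e
    · exact e.symm
    · have := mm_adj (σ := σ) hf p
      rw [← e, h] at this
      exact absurd this (G.irrefl)
  · have : c ≤ 0 + 2 := mm_far hσ hf hc hpq (h ▸ Rch.nil _)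
    omega

theorem mm_two {σ : Fin t × Bool → V} (hσ : Function.Injective σ) {G : SimpleGraph V} {f : V → V}
    (hf : ∀ v, G.Adj v (f v)) {c g : ℕ} (hc : DistGE G.Adj (Set.range σ) c)
    (hg : GirthGE G.Adj g) (hcg : c ≤ g + 1) {p q : Fin t × Bool} (hpq : p ≠ q) {n : ℕ}
    (hn : Rch (Two G (mm σ f)) n (mm σ f p) (mm σ f q)) : c ≤ n + 2 := by
  by_cases h : p.1 = q.1
  · rcases eq_or_flip h with e | e
    · exact absurd e.symm hpq
    · subst e
      have := hg _ _ (mm_adj (σ := σ) hf p) n (hn.mono ?_)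
      · omega
      · rintro a b ⟨h1, h2⟩
        refine ⟨h1, fun e => ?_⟩
        rw [Sym2.eq_iff] at e
        rcases e with e | e
        · exact h2 p e
        · exact h2 (flip p) (by rw [flip_flip]; exact e)
  · exact mm_far hσ hf hc h (hn.mono (fun a b h => h.1))

theorem dist_none {σ : Fin t × Bool → V} (k : ℕ)
    (G : SimpleGraph V) (m : Fin t × Bool → V) (c : ℕ)
    (hm : ∀ p q, p ≠ q → ∀ n, Rch (Two G m) n (m p) (m q) → c ≤ n + 2) :
    DistGE (Piece σ k G m none) (Set.range Sum.inl) c := by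
  rintro _ ⟨p, rfl⟩ _ ⟨q, rfl⟩ hne n hn
  have key := hn.inv (fun n w => match w with
      | .inl q => q = p ∨ ∃ a, Rch (Two G m) a (m p) (m q) ∧ a + 2 ≤ n
      | .inr (.inl _) => False
      | .inr (.inr v) => ∃ a, Rch (Two G m) a (m p) v ∧ a + 1 ≤ n) (Or.inl rfl) (by
    intro n w w' hP h
    rcases w with u | x | a <;> rcases w' with u' | y | b <;>
      simp only [Piece, LastAdj] at h hP ⊢
    · subst h
      rcases hP with rfl | ⟨a, ha, hle⟩
      · exact ⟨0, Rch.nil _, by omega⟩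
      · exact ⟨a, ha, by omega⟩
    · subst h
      obtain ⟨a, ha, hle⟩ := hP
      exact Or.inr ⟨a, ha, by omega⟩
    · obtain ⟨a, ha, hle⟩ := hP
      exact ⟨a + 1, ha.snoc h, by omega⟩)
  simp only at key
  rcases key with rfl | ⟨a, ha, hle⟩
  · exact absurd rfl hne
  · have := hm p q (fun e => hne (by rw [e])) a ha
    omega

theorem girth_none {σ : Fin t × Bool → V} (k : ℕ)
    (G : SimpleGraph V) (m : Fin t × Bool → V) (g : ℕ) (hg : GirthGE G.Adj g) :
    GirthGE (Piece σ k G m none) g := by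
  intro x y hxy n hn
  rcases x with p | x | a <;> rcases y with q | y | b <;> simp only [Piece, LastAdj] at hxy
  · exfalso
    have key := hn.inv (fun _ w => w = .inl p) rfl (by
      rintro n w w' rfl ⟨h1, h2⟩
      rcases w' with u' | y | b' <;> simp only [Piece, LastAdj] at h1
      subst h1 hxy
      exact absurd rfl h2)
    simp at key
  · exfalso
    have key := hn.inv (fun _ w => w ≠ .inl q) (by simp) (by
      rintro n w w' - ⟨h1, h2⟩ rfl
      rcases w with u' | y | b' <;> simp only [Piece, LastAdj] at h1
      subst h1 hxy
      exact absurd rfl h2)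
    simp at key
  · have key := hn.inv (fun n w => match w with
      | .inl q => ∃ l, Rch (Del G.Adj a b) l a (m q) ∧ l ≤ n
      | .inr (.inl _) => False
      | .inr (.inr v) => ∃ l, Rch (Del G.Adj a b) l a v ∧ l ≤ n) ⟨0, Rch.nil _, le_rfl⟩ (by
      rintro n w w' hP ⟨h, hne⟩
      rcases w with u | x | v <;> rcases w' with u' | y | v' <;>
        simp only [Piece, LastAdj] at h hP ⊢
      · subst h
        obtain ⟨l, hl, hle⟩ := hP
        exact ⟨l, hl, by omega⟩
      · subst h
        obtain ⟨l, hl, hle⟩ := hP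
        exact ⟨l, hl, by omega⟩
      · obtain ⟨l, hl, hle⟩ := hP
        refine ⟨l + 1, hl.snoc ⟨h.1, fun e => hne ?_⟩, by omega⟩
        simpa using e)
    simp only at key
    obtain ⟨l, hl, hle⟩ := key
    have := hg a b hxy.1 l hl
    omega

theorem piece_sep {σ : Fin t × Bool → V} (k : ℕ) (G : SimpleGraph V) (m : Fin t × Bool → V)
    (i j : Option (Fin k)) (hij : i ≠ j) (w u u' : Vtx σ k) (h : Piece σ k G m i w u)
    (h' : Piece σ k G m j w u') : w ∈ Set.range (Sum.inl : _ → Vtx σ k) := by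
  rcases w with p | x | a
  · exact ⟨p, rfl⟩
  · exfalso
    cases i <;> cases j <;> simp only [Piece, LastAdj, InCp] at h h'
    exact hij (by rw [← h.1, ← h'.1])
  · exfalso
    cases i <;> cases j <;> simp [Piece, InCp] at h h' hij

theorem big_girth {σ : Fin t × Bool → V} (hσ : Function.Injective σ) {G : SimpleGraph V}
    {f : V → V} (hf : ∀ v, G.Adj v (f v)) {c g : ℕ} (hc : DistGE G.Adj (Set.range σ) c)
    (hg : GirthGE G.Adj g) (hcg : c ≤ g + 1) (hgc : g ≤ 2 * c) (k : ℕ) :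
    GirthGE (Big σ k G (mm σ f)).Adj g := by
  refine amalgam (Piece σ k G (mm σ f)) (piece_symm σ k G _) (Set.range Sum.inl) g c hgc ?_ ?_
    (piece_sep k G _)
  · rintro (_ | i)
    · exact girth_none k G _ g hg
    · exact girth_some hσ k G _ g hg i
  · rintro (_ | i)
    · exact dist_none k G _ c (fun p q hpq n hn => mm_two hσ hf hc hg hcg hpq hn)
    · exact dist_some hσ k G _ c hc i

open Classical in
/-- The embedding of copy `i`. -/
noncomputable def emb (σ : Fin t × Bool → V) (k : ℕ) (i : Fin k) (v : V) : Vtx σ k :=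
  if h : v ∈ Set.range σ then .inl h.choose else .inr (.inl (i, ⟨v, h⟩))

theorem proj_emb (σ : Fin t × Bool → V) (k : ℕ) (i : Fin k) (v : V) :
    proj σ k (emb σ k i v) = v := by
  unfold emb
  split_ifs with h
  · exact h.choose_spec
  · rfl

theorem inCp_emb (σ : Fin t × Bool → V) (k : ℕ) (i : Fin k) (v : V) :
    InCp σ k i (emb σ k i v) := by
  unfold emb
  split_ifs with h <;> simp [InCp]

theorem emb_inj (σ : Fin t × Bool → V) (k : ℕ) (i : Fin k) : Function.Injective (emb σ k i) :=
  fun v w h => by rw [← proj_emb σ k i v, h, proj_emb]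

theorem big_egirth_le (σ : Fin t × Bool → V) (k : ℕ) (G : SimpleGraph V) (m : Fin t × Bool → V)
    (i : Fin k) : (Big σ k G m).egirth ≤ G.egirth := by
  let φ : G →g Big σ k G m := ⟨emb σ k i, fun {a b} h =>
    ⟨some i, inCp_emb σ k i a, inCp_emb σ k i b, by rw [proj_emb, proj_emb]; exact h⟩⟩
  exact SimpleGraph.IsContained.egirth_le ⟨⟨φ, emb_inj σ k i⟩⟩

theorem deg_mid {σ : Fin t × Bool → V} (hσ : Function.Injective σ) (k : ℕ) (G : SimpleGraph V)
    (m : Fin t × Bool → V) (x : Fin k × {v : V // v ∉ Set.range σ}) :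
    ((Big σ k G m).neighborSet (.inr (.inl x))).ncard = (G.neighborSet x.2.1).ncard := by
  rw [← Set.ncard_image_of_injective _ (emb_inj σ k x.1)]
  congr 1
  ext w
  simp only [SimpleGraph.mem_neighborSet, Set.mem_image]
  constructor
  · rintro ⟨i, h⟩
    cases i with
    | none => simp [Piece, LastAdj] at h
    | some i =>
      obtain ⟨h1, h2, h3⟩ := h
      simp only [InCp] at h1
      subst h1
      exact ⟨proj σ k w, h3, proj_inj hσ (inCp_emb _ _ _ _) h2 (proj_emb _ _ _ _)⟩
  · rintro ⟨v, hv, rfl⟩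
    exact ⟨some x.1, rfl, inCp_emb _ _ _ _, by rw [proj_emb]; exact hv⟩

theorem deg_last [Finite V] {σ : Fin t × Bool → V} (k : ℕ) (G : SimpleGraph V)
    (m : Fin t × Bool → V) (hm : Function.Injective m) (hadj : ∀ p, G.Adj (m p) (m (flip p)))
    (a : V) :
    ((Big σ k G m).neighborSet (.inr (.inr a))).ncard = (G.neighborSet a).ncard := by
  have hinj : Function.Injective (fun v : V => (.inr (.inr v) : Vtx σ k)) := by
    intro v w h; simpa using h
  by_cases ha : ∃ p, a = m p
  · obtain ⟨p, rfl⟩ := ha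
    have e : (Big σ k G m).neighborSet (.inr (.inr (m p))) =
        insert (.inl p) ((fun v : V => (.inr (.inr v) : Vtx σ k)) ''
          (G.neighborSet (m p) \ {m (flip p)})) := by
      ext w
      simp only [SimpleGraph.mem_neighborSet, Set.mem_insert_iff, Set.mem_image, Set.mem_sdiff,
        Set.mem_singleton_iff]
      constructor
      · rintro ⟨_ | i, h⟩
        · rcases w with q | y | b <;> simp only [Piece, LastAdj] at h
          · left; rw [hm h]
          · right; exact ⟨b, ⟨h.1, fun e => h.2 p ⟨rfl, e⟩⟩, rfl⟩
        · exact absurd h.1 (by simp [InCp])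
      · rintro (rfl | ⟨b, ⟨h1, h2⟩, rfl⟩)
        · exact ⟨none, rfl⟩
        · refine ⟨none, h1, ?_⟩
          rintro q ⟨e1, e2⟩
          rw [← hm e1] at e2
          exact h2 e2
    rw [e, Set.ncard_insert_of_notMem (by simp), Set.ncard_image_of_injective _ hinj]
    exact Set.ncard_sdiff_singleton_add_one (hadj p)
  · rw [← Set.ncard_image_of_injective _ hinj]
    congr 1
    ext w
    simp only [SimpleGraph.mem_neighborSet, Set.mem_image]
    constructor
    · rintro ⟨_ | i, h⟩
      · rcases w with q | y | b <;> simp only [Piece, LastAdj] at h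
        · exact absurd ⟨q, h⟩ ha
        · exact ⟨b, h.1, rfl⟩
      · exact absurd h.1 (by simp [InCp])
    · rintro ⟨b, h, rfl⟩
      exact ⟨none, h, fun q e => ha ⟨q, e.1⟩⟩

theorem deg_big [Finite V] {σ : Fin t × Bool → V} (k : ℕ) (G : SimpleGraph V)
    (m : Fin t × Bool → V) (p : Fin t × Bool) (hp : ∀ q, ¬ G.Adj (σ p) (σ q)) :
    ((Big σ k G m).neighborSet (.inl p)).ncard = (G.neighborSet (σ p)).ncard * k + 1 := by
  have e : (Big σ k G m).neighborSet (.inl p) =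
      insert (.inr (.inr (m p))) ((fun z : Fin k × V => emb σ k z.1 z.2) ''
        (Set.univ ×ˢ G.neighborSet (σ p))) := by
    ext w
    simp only [SimpleGraph.mem_neighborSet, Set.mem_insert_iff, Set.mem_image, Set.mem_prod,
      Set.mem_univ, true_and, Prod.exists]
    constructor
    · rintro ⟨_ | i, h⟩
      · rcases w with q | y | b <;> simp only [Piece, LastAdj] at h
        left; rw [h]
      · right
        obtain ⟨-, h2, h3⟩ := h
        rcases w with q | ⟨j, v⟩ | b <;> simp only [InCp, proj] at h2 h3
        · exact absurd h3 (hp q)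
        · refine ⟨j, v.1, h3, ?_⟩
          simp only [emb, v.2, dite_false]
    · rintro (rfl | ⟨i, v, h, rfl⟩)
      · exact ⟨none, rfl⟩
      · exact ⟨some i, trivial, inCp_emb _ _ _ _, by rw [proj_emb]; exact h⟩
  have hnr : ∀ v ∈ G.neighborSet (σ p), v ∉ Set.range σ := by
    rintro v hv ⟨q, rfl⟩
    exact hp q hv
  rw [e, Set.ncard_insert_of_notMem, Set.InjOn.ncard_image, Set.ncard_prod]
  · simp [Nat.mul_comm]
  · rintro ⟨i, v⟩ ⟨-, hv⟩ ⟨j, w⟩ ⟨-, hw⟩ h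
    have hv' := hnr v hv
    have hw' := hnr w hw
    simp only [emb, hv', hw', dite_false] at h
    simpa using h
  · rintro ⟨⟨i, v⟩, -, h⟩
    have := inCp_emb σ k i v
    simp only at h
    rw [h] at this
    exact this

end Construction

end Cage

theorem stmt_1 {V : Type*} [Fintype V] (r g k s n : ℕ)
    (hr : 2 ≤ r) (hg : 5 ≤ g) (hk : 1 ≤ k) (hs : 2 ≤ s) (hseven : Even s)
    (G : SimpleGraph V) (hcard : Fintype.card V = n)
    (hreg : ∀ v : V, (G.neighborSet v).ncard = r)
    (hgirth : G.egirth = g)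
    (S : Finset V) (hScard : S.card = s)
    (hSdist : ∀ u ∈ S, ∀ v ∈ S, u ≠ v → (((g + 1) / 2 : ℕ) : ℕ∞) ≤ G.edist u v) :
    ∃ (W : Type) (_ : Finite W) (H : SimpleGraph W),
      H.egirth = g ∧
      (∀ w : W, (H.neighborSet w).ncard = r ∨ (H.neighborSet w).ncard = r * k + 1) ∧
      (∃ w : W, (H.neighborSet w).ncard = r) ∧
      (∃ w : W, (H.neighborSet w).ncard = r * k + 1) ∧
      Nat.card W = k * (n - s) + n + s := by
  classical
  open Cage in
  obtain ⟨t, ht⟩ := hseven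
  have hcd : Fintype.card (Fin t × Bool) = Fintype.card S := by simp; omega
  let E : Fin t × Bool ≃ S := Fintype.equivOfCardEq hcd
  let σ : Fin t × Bool → V := fun p => (E p).1
  have hσ : Function.Injective σ := Subtype.val_injective.comp E.injective
  have hrange : Set.range σ = (S : Set V) := by
    ext v
    constructor
    · rintro ⟨p, rfl⟩; exact (E p).2
    · intro hv; exact ⟨E.symm ⟨v, hv⟩, by simp [σ]⟩
  have hne : ∀ v, ∃ w, G.Adj v w := by
    intro v
    have : (G.neighborSet v).Nonempty := by
      apply Set.nonempty_of_ncard_ne_zero; rw [hreg]; omega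
    exact this
  choose f hf using hne
  obtain ⟨c, hcdef⟩ : ∃ c, c = (g + 1) / 2 := ⟨_, rfl⟩
  have hc : DistGE G.Adj (Set.range σ) c := by
    rw [hrange]
    intro u hu v hv huv n hn
    obtain ⟨p, rfl⟩ := walk_of_rch hn
    have := (hSdist u hu v hv huv).trans p.edist_le
    rw [hcdef]
    exact_mod_cast this
  have hG : GirthGE G.Adj g := girthGE_of_egirth hgirth.ge
  have hmi := mm_inj hσ hf hc (by omega)
  have hnadj : ∀ p q, ¬ G.Adj (σ p) (σ q) := by
    intro p q h
    have := hc _ ⟨p, rfl⟩ _ ⟨q, rfl⟩ h.ne 1 (Rch.single h)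
    omega
  let H := Big σ k G (mm σ f)
  have hH1 : H.egirth = g := le_antisymm
    ((big_egirth_le σ k G _ ⟨0, by omega⟩).trans hgirth.le)
    (egirth_of_girthGE (big_girth hσ hf hc hG (by omega) (by omega) k))
  have hl : ∀ p, (H.neighborSet (.inl p)).ncard = r * k + 1 := fun p => by
    rw [← hreg (σ p)]; exact deg_big k G _ p (hnadj p)
  have hm : ∀ x, (H.neighborSet (.inr (.inl x))).ncard = r := fun x => by
    rw [← hreg x.2.1]; exact deg_mid hσ k G _ x
  have hla : ∀ a, (H.neighborSet (.inr (.inr a))).ncard = r := fun a => by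
    rw [← hreg a]; exact deg_last k G _ hmi (mm_adj hf) a
  let p0 : Fin t × Bool := (⟨0, by omega⟩, false)
  have hcardW : Nat.card (Vtx σ k) = k * (n - s) + n + s := by
    have h1 : Nat.card {v : V // v ∉ Set.range σ} = n - s := by
      rw [hrange]
      simp only [Finset.mem_coe, Nat.card_eq_fintype_card]
      rw [Fintype.card_subtype_compl, hcard]
      simp [hScard]
    rw [Nat.card_sum, Nat.card_sum, Nat.card_prod, Nat.card_prod, h1]
    simp only [Nat.card_eq_fintype_card, Fintype.card_fin, Fintype.card_bool, hcard]
    omega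
  let e : Vtx σ k ≃ Fin (Nat.card (Vtx σ k)) := Finite.equivFin _
  let ψ : H ≃g H.map e := SimpleGraph.Iso.map e H
  have hdeg : ∀ w, ((H.map e).neighborSet (e w)).ncard = (H.neighborSet w).ncard := by
    intro w
    exact (Set.ncard_congr' (ψ.mapNeighborSet w)).symm
  refine ⟨Fin (Nat.card (Vtx σ k)), inferInstance, H.map e, ?_, ?_, ?_, ?_, ?_⟩
  · rw [← ψ.egirth_eq]; exact hH1
  · intro w
    obtain ⟨w, rfl⟩ := e.surjective w
    rw [hdeg]
    rcases w with p | x | a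
    · exact Or.inr (hl p)
    · exact Or.inl (hm x)
    · exact Or.inl (hla a)
  · exact ⟨e (.inr (.inr (σ p0))), by rw [hdeg]; exact hla _⟩
  · exact ⟨e (.inl p0), by rw [hdeg]; exact hl _⟩
  · rw [← hcardW]; simp
end

section
/- Let r ≥ 2, g ≥ 5, k ≥ 1, l ≥ 1 be integers and let s ≥ 2 be an even integer. Suppose there exists a finite simple r-regular graph of girth g on n_g vertices that contains s distinct vertices which are pairwise at distance at least ⌈g/2⌉ from each other, and that also contains s/2 distinct edges which are pairwise at distance at least ⌈g/2⌉ from each other. Then there exists a finite simple graph of girth exactly g, in which every vertex has degree r or degree rk + l(r−1) and both degrees occur, whose number of vertices is exactly k·(n_g − s) + n_g + (l−1)·(n_g − s). -/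
/-- The distance between two edges (given as elements of `Sym2 V`), i.e. the minimum of the
(extended) graph distances between an endpoint of the first edge and an endpoint of the second. -/
noncomputable def edgeEDist {V : Type*} (G : SimpleGraph V) (e f : Sym2 V) : ℕ∞ :=
  ⨅ u ∈ e, ⨅ v ∈ f, G.edist u v

open SimpleGraph

/-- The inclusion of the `c`-th copy in the glued vertex set. -/
def gluePhi {A B ι : Type*} (c : ι) : A ⊕ B → A ⊕ (ι × B) := Sum.map id (Prod.mk c)

theorem gluePhi_injective {A B ι : Type*} (c : ι) :
    Function.Injective (gluePhi (A := A) (B := B) c) := by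
  rintro (a | b) (a' | b') h <;> simp_all [gluePhi]

/-- The graph obtained by gluing all `K c` along `A`. -/
def glue {A B ι : Type*} (K : ι → SimpleGraph (A ⊕ B)) : SimpleGraph (A ⊕ (ι × B)) where
  Adj u v := ∃ c x y, (K c).Adj x y ∧ gluePhi c x = u ∧ gluePhi c y = v
  symm := ⟨by
    rintro u v ⟨c, x, y, h, hx, hy⟩
    exact ⟨c, y, x, h.symm, hy, hx⟩⟩
  loopless := ⟨by
    rintro u ⟨c, x, y, h, hx, hy⟩
    exact h.ne (gluePhi_injective c (hx.trans hy.symm))⟩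

/-- The inclusion homomorphism. -/
def glueHom {A B ι : Type*} (K : ι → SimpleGraph (A ⊕ B)) (c : ι) : K c →g glue K where
  toFun := gluePhi c
  map_rel' := fun h => ⟨c, _, _, h, rfl, rfl⟩

theorem glue_adj_inr {A B ι : Type*} {K : ι → SimpleGraph (A ⊕ B)} {c : ι} {b : B}
    {w : A ⊕ (ι × B)} (h : (glue K).Adj (.inr (c, b)) w) :
    ∃ y, (K c).Adj (.inr b) y ∧ gluePhi c y = w := by
  obtain ⟨c', x, y, h, hx, hy⟩ := h
  rcases x with a | b'
  · simp [gluePhi] at hx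
  · simp only [gluePhi, Sum.map_inr, Sum.inr.injEq, Prod.mk.injEq] at hx
    obtain ⟨rfl, rfl⟩ := hx
    exact ⟨y, h, hy⟩

theorem glue_walk_hub {A B ι : Type*} {K : ι → SimpleGraph (A ⊕ B)} {d : ℕ}
    (hsep : ∀ c a a', a ≠ a' → ∀ p : (K c).Walk (.inl a) (.inl a'), d ≤ p.length)
    {u v : A ⊕ (ι × B)} (p : (glue K).Walk u v) (a' : A) (hv : v = .inl a') :
    ∀ c x, gluePhi c x = u →
      (∃ q : (K c).Walk x (.inl a'), q.length ≤ p.length) ∨ d ≤ p.length := by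
  induction p with
  | nil =>
    rintro c x rfl
    rcases x with a | b
    · simp only [gluePhi, Sum.map_inl, id, Sum.inl.injEq] at hv
      subst hv
      exact .inl ⟨.nil, by simp⟩
    · simp [gluePhi] at hv
  | @cons u w v h q ih =>
    rintro c x hx
    obtain ⟨c0, x0, w0, h0, hx0, hw0⟩ := id h
    rcases ih hv c0 w0 hw0 with ⟨q', hq'⟩ | hd
    · rcases x with a | b
      · have : x0 = .inl a := by
          rw [← hx0] at hx
          rcases x0 with a0 | b0 <;> simp [gluePhi] at hx ⊢
          exact hx.symm
        subst this
        by_cases haa : a = a'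
        · subst haa
          exact .inl ⟨.nil, by simp⟩
        · right
          have := hsep c0 a a' haa (.cons h0 q')
          simp only [Walk.length_cons] at this ⊢
          omega
      · rw [← hx0] at hx
        rcases x0 with a0 | b0
        · simp [gluePhi] at hx
        · simp only [gluePhi, Sum.map_inr, Sum.inr.injEq, Prod.mk.injEq] at hx
          obtain ⟨rfl, rfl⟩ := hx
          exact .inl ⟨.cons h0 q', by simpa using hq'⟩
    · right
      simp only [Walk.length_cons]
      omega

theorem glue_hub_sep {A B ι : Type*} {K : ι → SimpleGraph (A ⊕ B)} {d : ℕ} [Nonempty ι]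
    (hsep : ∀ c a a', a ≠ a' → ∀ p : (K c).Walk (.inl a) (.inl a'), d ≤ p.length)
    {a a' : A} (haa : a ≠ a') (p : (glue K).Walk (.inl a) (.inl a')) : d ≤ p.length := by
  rcases glue_walk_hub hsep p a' rfl (Classical.arbitrary ι) (.inl a) rfl with ⟨q, hq⟩ | h
  · exact (hsep _ _ _ haa q).trans hq
  · exact h

theorem glue_lift {A B ι : Type*} {K : ι → SimpleGraph (A ⊕ B)} {c : ι}
    {u v : A ⊕ (ι × B)} (p : (glue K).Walk u v) (hp : p.IsPath)
    (hh : ∀ a, .inl a ∈ p.support → .inl a = v) :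
    ∀ b, (hu : gluePhi c (.inr b) = u) →
      ∃ y, ∃ hy : gluePhi c y = v, ∃ q : (K c).Walk (.inr b) y,
        (q.map (glueHom K c)).copy hu hy = p := by
  induction p with
  | nil =>
    rintro b rfl
    exact ⟨_, rfl, .nil, rfl⟩
  | @cons u w v h q ih =>
    rintro b rfl
    obtain ⟨y, hy, rfl⟩ := glue_adj_inr h
    rw [Walk.cons_isPath_iff] at hp
    rcases y with a | b'
    · have hav := hh a (by
        rw [Walk.support_cons]
        exact List.mem_cons_of_mem _ q.start_mem_support)
      subst hav
      have : q = .nil := (Walk.isPath_iff_nil.1 hp.1).eq_nil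
      subst this
      exact ⟨_, rfl, .cons hy .nil, rfl⟩
    · obtain ⟨y', rfl, q', rfl⟩ := ih hp.1 (fun a ha => hh a (by
        rw [Walk.support_cons]
        exact List.mem_cons_of_mem _ ha)) b' rfl
      exact ⟨_, rfl, .cons hy q', rfl⟩

theorem glue_cycle_one {A B ι : Type*} {K : ι → SimpleGraph (A ⊕ B)} {g : ℕ}
    (hK : ∀ c, (g : ℕ∞) ≤ (K c).egirth)
    (hadj : ∀ c a a', ¬ (K c).Adj (.inl a) (.inl a'))
    {u : A ⊕ (ι × B)} (p : (glue K).Walk u u) (hp : p.IsCycle)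
    (hh : ∀ a, .inl a ∈ p.support → .inl a = u) : g ≤ p.length := by
  cases p with
  | nil => simp at hp
  | @cons _ w _ h q =>
    have hp' := hp
    rw [Walk.cons_isCycle_iff] at hp'
    have hh' : ∀ a, .inl a ∈ q.support → .inl a = u := fun a ha => hh a (by
        rw [Walk.support_cons]
        exact List.mem_cons_of_mem _ ha)
    rcases w with a | ⟨c, b⟩
    · exact absurd (hh' a q.start_mem_support) h.ne'
    · obtain ⟨y, rfl, q', rfl⟩ := glue_lift (c := c) q hp'.1 hh' b rfl
      obtain ⟨y', hy', he⟩ := glue_adj_inr h.symm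
      obtain rfl := gluePhi_injective c he
      have hc : ((Walk.cons hy'.symm q').map (glueHom K c)).IsCycle := hp
      rw [Walk.isCycle_map_iff_of_injective (gluePhi_injective c)] at hc
      have := (hK c).trans (egirth_le_length hc)
      have h2 : g ≤ (Walk.cons hy'.symm q').length := by exact_mod_cast this
      exact h2.trans_eq (Walk.length_map (glueHom K c) (Walk.cons hy'.symm q')).symm

theorem glue_egirth {A B ι : Type*} {K : ι → SimpleGraph (A ⊕ B)} {g d : ℕ} [Nonempty ι]
    (hK : ∀ c, (g : ℕ∞) ≤ (K c).egirth)
    (hsep : ∀ c a a', a ≠ a' → ∀ p : (K c).Walk (.inl a) (.inl a'), d ≤ p.length)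
    (hd : 2 ≤ d) (hgd : g ≤ 2 * d) : (g : ℕ∞) ≤ (glue K).egirth := by
  classical
  have hadj : ∀ c a a', ¬ (K c).Adj (.inl a) (.inl a') := by
    intro c a a' h
    have := hsep c a a' (by rintro rfl; exact h.ne rfl) (.cons h .nil)
    simp at this
    omega
  rw [le_egirth]
  intro u w hw
  norm_cast
  by_cases hex : ∃ a, .inl a ∈ w.support
  · obtain ⟨a, ha⟩ := hex
    rw [← Walk.length_rotate w _ ha]
    have hc : (w.rotate _ ha).IsCycle := by simpa using hw
    generalize w.rotate _ ha = z at hc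
    by_cases h1 : ∀ a', .inl a' ∈ z.support → a' = a
    · exact glue_cycle_one hK hadj z hc (fun a' h => by rw [h1 a' h])
    · push Not at h1
      obtain ⟨a', ha', hne⟩ := h1
      have e := congrArg Walk.length (z.take_spec ha')
      rw [Walk.length_append] at e
      have := glue_hub_sep hsep hne.symm (z.takeUntil _ ha')
      have := glue_hub_sep hsep hne (z.dropUntil _ ha')
      omega
  · push Not at hex
    exact glue_cycle_one hK hadj w hw (fun a h => absurd h (hex a))

theorem glue_egirth_le {A B ι : Type*} (K : ι → SimpleGraph (A ⊕ B)) (c : ι) :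
    (glue K).egirth ≤ (K c).egirth :=
  IsContained.egirth_le ⟨⟨glueHom K c, gluePhi_injective c⟩⟩

theorem glue_deg_inr {A B ι : Type*} (K : ι → SimpleGraph (A ⊕ B)) (c : ι) (b : B) :
    ((glue K).neighborSet (.inr (c, b))).ncard = ((K c).neighborSet (.inr b)).ncard := by
  rw [← Set.ncard_image_of_injective _ (gluePhi_injective (A := A) (B := B) c)]
  congr 1
  ext w
  simp only [mem_neighborSet, Set.mem_image]
  constructor
  · exact glue_adj_inr
  · rintro ⟨y, h, rfl⟩
    exact ⟨c, _, _, h, rfl, rfl⟩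

theorem glue_deg_inl {A B ι : Type*} [Finite B] [Fintype ι] (K : ι → SimpleGraph (A ⊕ B))
    (hadj : ∀ c a a', ¬ (K c).Adj (.inl a) (.inl a')) (a : A) :
    ((glue K).neighborSet (.inl a)).ncard = ∑ c, ((K c).neighborSet (.inl a)).ncard := by
  have key : ∀ c, ((K c).neighborSet (.inl a)).ncard
      = Nat.card {b : B // (K c).Adj (.inl a) (.inr b)} := by
    intro c
    rw [← Nat.card_coe_set_eq]
    refine (Nat.card_congr (Equiv.ofBijective
      (fun b => ⟨.inr b.1, b.2⟩) ⟨?_, ?_⟩)).symm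
    · rintro ⟨b, _⟩ ⟨b', _⟩ h
      have h' := congrArg Subtype.val h
      simp only [Sum.inr.injEq] at h'
      subst h'
      rfl
    · rintro ⟨a' | b, h⟩
      · exact absurd h (hadj c a a')
      · exact ⟨⟨b, h⟩, rfl⟩
  simp_rw [key]
  rw [← Nat.card_sigma, ← Nat.card_coe_set_eq]
  refine (Nat.card_congr (Equiv.ofBijective
      (fun b => ⟨.inr (b.1, b.2.1), b.1, _, _, b.2.2, rfl, rfl⟩) ⟨?_, ?_⟩)).symm
  · rintro ⟨c, b, _⟩ ⟨c', b', _⟩ h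
    simp at h
    obtain ⟨rfl, rfl⟩ := h
    rfl
  · rintro ⟨w, c, x, y, h, hx, rfl⟩
    rcases x with a' | b'
    · simp only [gluePhi, Sum.map_inl, id, Sum.inl.injEq] at hx
      subst hx
      rcases y with a'' | b
      · exact absurd h (hadj c _ _)
      · exact ⟨⟨c, b, h⟩, rfl⟩
    · simp [gluePhi] at hx

theorem exists_hub_equiv {V : Type*} [Fintype V] {n s : ℕ} (hcard : Fintype.card V = n)
    (S : Finset V) (hS : S.card = s) :
    ∃ e : Fin s ⊕ Fin (n - s) ≃ V, (∀ a, e (.inl a) ∈ S) ∧ ∀ b, e (.inr b) ∉ S := by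
  classical
  have e1 : Fin s ≃ {x // x ∈ S} := (Fintype.equivFinOfCardEq (by simp [hS])).symm
  have e2 : Fin (n - s) ≃ {x // ¬ x ∈ S} :=
    (Fintype.equivFinOfCardEq (by
      rw [Fintype.card_subtype_compl]; simp [hS, hcard])).symm
  refine ⟨(Equiv.sumCongr e1 e2).trans (Equiv.sumCompl _), ?_, ?_⟩
  · intro a; simp
  · intro b; simpa using (e2 b).2

theorem iso_deg {V W : Type*} {G : SimpleGraph V} {H : SimpleGraph W} (f : G ≃g H) (v : V) :
    (G.neighborSet v).ncard = (H.neighborSet (f v)).ncard := by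
  rw [← Nat.card_coe_set_eq, ← Nat.card_coe_set_eq]
  exact Nat.card_congr (f.mapNeighborSet v)

theorem edgeEDist_le {V : Type*} (G : SimpleGraph V) {e f : Sym2 V} {u v : V}
    (hu : u ∈ e) (hv : v ∈ f) : edgeEDist G e f ≤ G.edist u v :=
  (iInf₂_le u hu).trans (iInf₂_le v hv)

theorem stmt_2 {V : Type*} [Fintype V] (r g k l s n : ℕ)
    (hr : 2 ≤ r) (hg : 5 ≤ g) (hk : 1 ≤ k) (hl : 1 ≤ l) (hs : 2 ≤ s) (hseven : Even s)
    (G : SimpleGraph V) (hcard : Fintype.card V = n)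
    (hreg : ∀ v : V, (G.neighborSet v).ncard = r)
    (hgirth : G.egirth = g)
    (S : Finset V) (hScard : S.card = s)
    (hSdist : ∀ u ∈ S, ∀ v ∈ S, u ≠ v → (((g + 1) / 2 : ℕ) : ℕ∞) ≤ G.edist u v)
    (T : Finset (Sym2 V)) (hTE : ↑T ⊆ G.edgeSet) (hTcard : T.card = s / 2)
    (hTdist : ∀ e ∈ T, ∀ f ∈ T, e ≠ f → (((g + 1) / 2 : ℕ) : ℕ∞) ≤ edgeEDist G e f) :
    ∃ (W : Type) (_ : Finite W) (H : SimpleGraph W),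
      H.egirth = g ∧
      (∀ w : W, (H.neighborSet w).ncard = r ∨ (H.neighborSet w).ncard = r * k + l * (r - 1)) ∧
      (∃ w : W, (H.neighborSet w).ncard = r) ∧
      (∃ w : W, (H.neighborSet w).ncard = r * k + l * (r - 1)) ∧
      Nat.card W = k * (n - s) + n + (l - 1) * (n - s) := by
  classical
  have huniq : ∀ e ∈ T, ∀ f ∈ T, ∀ v, v ∈ e → v ∈ f → e = f := by
    intro e he f hf v hve hvf
    by_contra hne
    have h := (hTdist e he f hf hne).trans (edgeEDist_le G hve hvf)
    rw [edist_self] at h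
    norm_cast at h
    omega
  let S' : Finset V := T.biUnion Sym2.toFinset
  have hS' : ∀ v, v ∈ S' ↔ ∃ e ∈ T, v ∈ e := by intro v; simp [S']
  have hS'card : S'.card = s := by
    rw [Finset.card_biUnion]
    · rw [Finset.sum_congr rfl (fun e he => Sym2.card_toFinset_of_not_isDiag e
        (G.not_isDiag_of_mem_edgeSet (hTE he)))]
      rw [Finset.sum_const, hTcard, smul_eq_mul]
      exact Nat.div_mul_cancel hseven.two_dvd
    · intro e he f hf hne
      change Disjoint e.toFinset f.toFinset
      rw [Finset.disjoint_left]
      intro v hv hv'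
      exact hne (huniq e he f hf v (Sym2.mem_toFinset.1 hv) (Sym2.mem_toFinset.1 hv'))
  let G' := G.deleteEdges (T : Set (Sym2 V))
  have hG' : G' ≤ G := G.deleteEdges_le _
  have hsepG : ∀ u ∈ S, ∀ v ∈ S, u ≠ v → ∀ p : G.Walk u v, (g + 1) / 2 ≤ p.length := by
    intro u hu v hv hne p
    exact_mod_cast (hSdist u hu v hv hne).trans (edist_le p)
  have hsepG' : ∀ u ∈ S', ∀ v ∈ S', u ≠ v → ∀ p : G'.Walk u v, (g + 1) / 2 ≤ p.length := by
    intro u hu v hv hne p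
    rw [hS'] at hu hv
    obtain ⟨e, he, hue⟩ := hu
    obtain ⟨f, hf, hvf⟩ := hv
    by_cases hef : e = f
    · subst hef
      have hee : e = s(u, v) := (Sym2.mem_and_mem_iff hne).1 ⟨hue, hvf⟩
      subst hee
      have hadj : G.Adj v u := (show G.Adj u v from hTE he).symm
      have hp : (p.bypass.mapLe hG').IsPath := (Walk.bypass_isPath p).mapLe hG'
      have hc : (Walk.cons hadj (p.bypass.mapLe hG')).IsCycle := by
        rw [Walk.cons_isCycle_iff]
        refine ⟨hp, fun hm => ?_⟩
        rw [Walk.edges_mapLe_eq_edges] at hm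
        have := Walk.edges_subset_edgeSet _ hm
        have h2 : G'.Adj v u := this
        rw [deleteEdges_adj, Sym2.eq_swap] at h2
        exact h2.2 he
      have h1 := egirth_le_length hc
      rw [hgirth] at h1
      have h2 : g ≤ (Walk.cons hadj (p.bypass.mapLe hG')).length := by exact_mod_cast h1
      have h3 := p.length_bypass_le_length
      simp at h2
      omega
    · have := ((hTdist e he f hf hef).trans (edgeEDist_le G hue hvf)).trans
        (edist_le (p.mapLe hG'))
      have h2 : (g + 1) / 2 ≤ (p.mapLe hG').length := by exact_mod_cast this
      simpa using h2
  have hdeg1 : ∀ v ∈ S', (G'.neighborSet v).ncard = r - 1 := by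
    intro v hv
    obtain ⟨e, he, hve⟩ := (hS' v).1 hv
    obtain ⟨w, rfl⟩ := hve
    have hadj : G.Adj v w := hTE he
    rw [← hreg v, ← Set.ncard_sdiff_singleton_of_mem (show w ∈ G.neighborSet v from hadj)]
    congr 1
    ext x
    simp only [G', mem_neighborSet, deleteEdges_adj, Set.mem_sdiff, Set.mem_singleton_iff]
    refine and_congr_right fun _ => not_congr ⟨fun h => ?_, fun h => ?_⟩
    · have := huniq _ h _ he v (Sym2.mem_mk_left _ _) (Sym2.mem_mk_left _ _)
      rcases Sym2.eq_iff.1 this with h | h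
      · exact h.2
      · exact absurd h.1 hadj.ne
    · subst h; exact he
  have hdeg2 : ∀ v, v ∉ S' → (G'.neighborSet v).ncard = r := by
    intro v hv
    rw [← hreg v]
    congr 1
    ext x
    simp only [G', mem_neighborSet, deleteEdges_adj]
    refine ⟨fun h => h.1, fun h => ⟨h, fun hm => hv ?_⟩⟩
    exact (hS' v).2 ⟨_, hm, Sym2.mem_mk_left _ _⟩
  obtain ⟨e, he1, he2⟩ := exists_hub_equiv hcard S hScard
  obtain ⟨e', he1', he2'⟩ := exists_hub_equiv hcard S' hS'card
  let K : Fin k ⊕ Fin l → SimpleGraph (Fin s ⊕ Fin (n - s)) :=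
    Sum.elim (fun _ => G.comap e) (fun _ => G'.comap e')
  let i1 : G.comap e ≃g G := SimpleGraph.Iso.comap e G
  let i2 : G'.comap e' ≃g G' := SimpleGraph.Iso.comap e' G'
  have hK : ∀ c, (g : ℕ∞) ≤ (K c).egirth := by
    rintro (c | c)
    · change _ ≤ (G.comap e).egirth
      rw [i1.egirth_eq, hgirth]
    · change _ ≤ (G'.comap e').egirth
      rw [i2.egirth_eq, ← hgirth]
      exact egirth_anti hG'
  have hsep : ∀ c a a', a ≠ a' → ∀ p : (K c).Walk (.inl a) (.inl a'),
      (g + 1) / 2 ≤ p.length := by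
    rintro (c | c) a a' hne p
    · have := hsepG _ (he1 a) _ (he1 a') (by simpa using hne) (Walk.map i1.toHom p)
      exact this.trans_eq (Walk.length_map _ _)
    · have := hsepG' _ (he1' a) _ (he1' a') (by simpa using hne) (Walk.map i2.toHom p)
      exact this.trans_eq (Walk.length_map _ _)
  have hadj : ∀ c a a', ¬ (K c).Adj (.inl a) (.inl a') := by
    intro c a a' h
    have := hsep c a a' (by rintro rfl; exact h.ne rfl) (.cons h .nil)
    simp at this
    omega
  have : Nonempty (Fin k ⊕ Fin l) := ⟨.inl ⟨0, hk⟩⟩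
  have hinr : ∀ c b, ((glue K).neighborSet (.inr (c, b))).ncard = r := by
    intro c b
    rw [glue_deg_inr]
    rcases c with c | c
    · exact (iso_deg i1 _).trans (hreg _)
    · exact (iso_deg i2 _).trans (hdeg2 _ (he2' b))
  have hinl : ∀ a, ((glue K).neighborSet (.inl a)).ncard = r * k + l * (r - 1) := by
    intro a
    rw [glue_deg_inl K hadj, Fintype.sum_sum_type]
    have h1 : ∀ c, ((K (.inl c)).neighborSet (.inl a)).ncard = r :=
      fun c => (iso_deg i1 (.inl a)).trans (hreg _)
    have h2 : ∀ c, ((K (.inr c)).neighborSet (.inl a)).ncard = r - 1 :=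
      fun c => (iso_deg i2 (.inl a)).trans (hdeg1 _ (he1' a))
    simp_rw [h1, h2]
    simp [mul_comm]
  have hsn : s ≤ n := by rw [← hScard, ← hcard]; exact S.card_le_univ
  have hlt : s < n := by
    rcases hsn.lt_or_eq with h | h
    · exact h
    · exfalso
      have hne : (G.neighborSet (e (.inl ⟨0, by omega⟩))).Nonempty := by
        apply Set.nonempty_of_ncard_ne_zero
        rw [hreg]; omega
      obtain ⟨x, hx⟩ := hne
      obtain ⟨y, rfl⟩ := e.surjective x
      rcases y with a | b
      · exact hadj (.inl ⟨0, hk⟩) _ a hx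
      · have := b.2
        omega
  refine ⟨Fin s ⊕ ((Fin k ⊕ Fin l) × Fin (n - s)), inferInstance, glue K, ?_, ?_, ?_, ?_, ?_⟩
  · refine le_antisymm ?_ (glue_egirth hK hsep (by omega) (by omega))
    refine (glue_egirth_le K (.inl ⟨0, hk⟩)).trans ?_
    change (G.comap e).egirth ≤ _
    rw [i1.egirth_eq, hgirth]
  · rintro (a | ⟨c, b⟩)
    · exact .inr (hinl a)
    · exact .inl (hinr c b)
  · exact ⟨.inr (.inl ⟨0, hk⟩, ⟨0, by omega⟩), hinr _ _⟩
  · exact ⟨.inl ⟨0, by omega⟩, hinl _⟩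
  · obtain ⟨m, rfl⟩ := Nat.exists_eq_add_of_le hsn
    obtain ⟨l', rfl⟩ := Nat.exists_eq_add_of_le hl
    simp
    ring
end

section
/- Let g ≥ 6 be an even integer and let G be a finite simple 3-regular graph of girth g on n_g vertices containing at least two vertices at distance g/2 from each other. Let m = 3k + t with k ≥ 1 an integer, t ∈ {0,1,2}, and m > 3 (so k ≥ 2 when t = 0). Then there exists a finite simple graph of girth exactly g in which every vertex has degree 3 or degree m and both degrees occur, whose number of vertices equals k(n_g − 2) + 2 if t = 0, equals k(n_g − 2) + n_g + 2 if t = 1, and equals k(n_g − 2) + n_g if t = 2. -/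
namespace Glue

open SimpleGraph

universe u v

/-- `Rch G x n y`: there is a walk of length `n` from `x` to `y`. -/
inductive Rch {V : Type u} (G : SimpleGraph V) (x : V) : ℕ → V → Prop
  | nil : Rch G x 0 x
  | snoc {n : ℕ} {y z : V} : Rch G x n y → G.Adj y z → Rch G x (n + 1) z

variable {V : Type u} {W : Type v}

theorem Rch.trans {G : SimpleGraph V} {x y z : V} {m n : ℕ} (h : Rch G x m y)
    (h' : Rch G y n z) : Rch G x (m + n) z := by
  induction h' with
  | nil => exact h
  | snoc _ ha ih => exact Rch.snoc ih ha

theorem Rch.symm {G : SimpleGraph V} {x y : V} {m : ℕ} (h : Rch G x m y) : Rch G y m x := by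
  induction h with
  | nil => exact Rch.nil
  | snoc _ ha ih =>
    have := (Rch.snoc Rch.nil ha.symm).trans ih
    rwa [Nat.zero_add, Nat.add_comm] at this

theorem Rch.mono {G G' : SimpleGraph V} (hle : G ≤ G') {x y : V} {m : ℕ} (h : Rch G x m y) :
    Rch G' x m y := by
  induction h with
  | nil => exact Rch.nil
  | snoc _ ha ih => exact Rch.snoc ih (hle ha)

theorem Rch.of_walk {G : SimpleGraph V} {x y : V} (p : G.Walk x y) : Rch G x p.length y := by
  induction p with
  | nil => exact Rch.nil
  | cons h p ih =>
    have := (Rch.snoc Rch.nil h).trans ih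
    rwa [Nat.zero_add, Nat.add_comm] at this

theorem Rch.exists_walk {G : SimpleGraph V} {x y : V} {n : ℕ} (h : Rch G x n y) :
    ∃ p : G.Walk x y, p.length = n := by
  induction h with
  | nil => exact ⟨Walk.nil, rfl⟩
  | snoc _ ha ih =>
    obtain ⟨p, hp⟩ := ih
    exact ⟨p.concat ha, by simp [hp]⟩

/-- Remove the edge `xy`. -/
def del (G : SimpleGraph V) (x y : V) : SimpleGraph V := G.deleteEdges {s(x, y)}

theorem del_adj {G : SimpleGraph V} {x y u v : V} :
    (del G x y).Adj u v ↔ G.Adj u v ∧ ¬ (u = x ∧ v = y ∨ u = y ∧ v = x) := by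
  simp [del, deleteEdges_adj]

theorem del_le {G : SimpleGraph V} {x y : V} : del G x y ≤ G := deleteEdges_le _

/-- Girth at least `g`. -/
def GB (G : SimpleGraph V) (g : ℕ) : Prop :=
  ∀ x y, G.Adj x y → ∀ n, Rch (del G x y) x n y → g ≤ n + 1

theorem GB.mono {G G' : SimpleGraph V} {g : ℕ} (hle : G ≤ G') (h : GB G' g) : GB G g := by
  intro x y hxy n hn
  refine h x y (hle hxy) n (hn.mono ?_)
  intro u v huv
  rw [del_adj] at huv ⊢
  exact ⟨hle huv.1, huv.2⟩

theorem GB.le_egirth {G : SimpleGraph V} {g : ℕ} (h : GB G g) : (g : ℕ∞) ≤ G.egirth := by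
  rw [SimpleGraph.le_egirth]
  intro a w hw
  cases w with
  | nil => simp at hw
  | cons hadj p =>
    rw [Walk.cons_isCycle_iff] at hw
    have h1 := Rch.of_walk (p.toDeleteEdge _ hw.2)
    have := h _ _ hadj _ h1.symm
    rw [Walk.length_cons]
    simp only [Walk.toDeleteEdge, Walk.toDeleteEdges, Walk.length_transfer] at this
    exact_mod_cast this

theorem GB.of_le_egirth {G : SimpleGraph V} {g : ℕ} (h : (g : ℕ∞) ≤ G.egirth) : GB G g := by
  classical
  intro x y hxy n hn
  obtain ⟨p, hp⟩ := hn.symm.exists_walk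
  have hle : (del G x y) ≤ G := del_le
  have hpath := p.bypass_isPath
  have hcyc : (Walk.cons hxy (p.bypass.mapLe hle)).IsCycle := by
    rw [Walk.cons_isCycle_iff]
    refine ⟨(Walk.isPath_mapLe hle).2 hpath, ?_⟩
    intro hmem
    have hmem' : s(x, y) ∈ p.bypass.edges := by simpa using hmem
    have := Walk.edges_subset_edgeSet _ hmem'
    rw [mem_edgeSet, del_adj] at this
    exact this.2 (Or.inl ⟨rfl, rfl⟩)
  have h2 := (SimpleGraph.le_egirth.1 h) _ _ hcyc
  have h3 : g ≤ p.bypass.length + 1 := by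
    rw [Walk.length_cons] at h2
    simp only [Walk.length_map, Walk.mapLe] at h2
    exact_mod_cast h2
  have := p.length_bypass_le_length
  omega

/-! Mapping along an embedding -/

theorem Rch.of_map {G : SimpleGraph V} (f : V ↪ W) {x : V} {n : ℕ} {z : W}
    (h : Rch (G.map f) (f x) n z) : ∃ y, f y = z ∧ Rch G x n y := by
  induction h with
  | nil => exact ⟨x, rfl, Rch.nil⟩
  | snoc _ ha ih =>
    obtain ⟨y, hy, hr⟩ := ih
    rw [SimpleGraph.map_adj] at ha
    obtain ⟨u, v, huv, hu, hv⟩ := ha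
    have : u = y := f.injective (hu.trans hy.symm)
    subst this
    exact ⟨v, hv, hr.snoc huv⟩

theorem Rch.of_map' {G : SimpleGraph V} (f : V ↪ W) {x y : V} {n : ℕ}
    (h : Rch (G.map f) (f x) n (f y)) : Rch G x n y := by
  obtain ⟨z, hz, hr⟩ := h.of_map
  rwa [← f.injective hz]

theorem GB.map {G : SimpleGraph V} (f : V ↪ W) {g : ℕ} (h : GB G g) : GB (G.map f) g := by
  intro x y hxy n hn
  rw [SimpleGraph.map_adj] at hxy
  obtain ⟨x, y, hxy, rfl, rfl⟩ := hxy
  refine h x y hxy n (Rch.of_map' f (hn.mono ?_))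
  intro u v huv
  rw [del_adj] at huv
  obtain ⟨huv, hne⟩ := huv
  rw [SimpleGraph.map_adj] at huv ⊢
  obtain ⟨u, v, huv, rfl, rfl⟩ := huv
  refine ⟨u, v, del_adj.2 ⟨huv, ?_⟩, rfl, rfl⟩
  intro hh
  apply hne
  rcases hh with ⟨rfl, rfl⟩ | ⟨rfl, rfl⟩ <;> simp

theorem nbr_map (G : SimpleGraph V) (f : V ↪ W) (x : V) :
    (G.map f).neighborSet (f x) = f '' G.neighborSet x := by
  ext z
  simp only [mem_neighborSet, SimpleGraph.map_adj, Set.mem_image]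
  constructor
  · rintro ⟨u, v, huv, hu, rfl⟩
    rw [← f.injective hu]
    exact ⟨v, huv, rfl⟩
  · rintro ⟨v, hv, rfl⟩
    exact ⟨x, v, hv, rfl, rfl⟩

theorem nbr_map_empty (G : SimpleGraph V) (f : V ↪ W) (w : W) (hw : ∀ x, f x ≠ w) :
    (G.map f).neighborSet w = ∅ := by
  ext z
  simp only [mem_neighborSet, SimpleGraph.map_adj, Set.mem_empty_iff_false, iff_false]
  rintro ⟨u, v, huv, hu, rfl⟩
  exact hw _ hu

theorem ncard_map (G : SimpleGraph V) (f : V ↪ W) (x : V) :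
    ((G.map f).neighborSet (f x)).ncard = (G.neighborSet x).ncard := by
  rw [nbr_map, Set.ncard_image_of_injective _ f.injective]

/-- A cycle of length `g` exists. -/
def HasCyc (G : SimpleGraph V) (g : ℕ) : Prop := ∃ (v : V) (p : G.Walk v v), p.IsCycle ∧ p.length = g

theorem HasCyc.map {G : SimpleGraph V} (f : V ↪ W) {g : ℕ} (h : HasCyc G g) :
    HasCyc (G.map f) g := by
  obtain ⟨v, p, hp, hl⟩ := h
  refine ⟨_, p.map (Embedding.map f G).toHom, hp.map (Embedding.map f G).injective,
    (Walk.length_map _ _).trans hl⟩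

theorem HasCyc.mono {G G' : SimpleGraph V} (hle : G ≤ G') {g : ℕ} (h : HasCyc G g) :
    HasCyc G' g := by
  obtain ⟨v, p, hp, hl⟩ := h
  exact ⟨v, p.mapLe hle, hp.mapLe hle, by simpa [Walk.mapLe] using hl⟩

/-! The gluing lemma -/

theorem glue_aux (H1 H2 : SimpleGraph W) (S1 S2 : Set W) (a b : W) (g h : ℕ)
    (h1 : ∀ u v, H1.Adj u v → u ∈ S1) (h2 : ∀ u v, H2.Adj u v → u ∈ S2)
    (hS : ∀ w, w ∈ S1 → w ∈ S2 → w = a ∨ w = b)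
    (gb1 : GB H1 g)
    (d1 : ∀ n, Rch H1 a n b → h ≤ n) (d2 : ∀ n, Rch H2 a n b → h ≤ n) (hgh : g ≤ 2 * h)
    (x y : W) (hxy : H1.Adj x y) (n : ℕ) (hn : Rch (del (H1 ⊔ H2) x y) x n y) : g ≤ n + 1 := by
  let opp : W → W → Prop := fun c d => (c = a ∧ d = b) ∨ (c = b ∧ d = a)
  have od1 : ∀ c d, opp c d → ∀ n, Rch H1 c n d → h ≤ n := by
    rintro c d (⟨rfl, rfl⟩ | ⟨rfl, rfl⟩) n hr
    · exact d1 n hr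
    · exact d1 n hr.symm
  have od2 : ∀ c d, opp c d → ∀ n, Rch H2 c n d → h ≤ n := by
    rintro c d (⟨rfl, rfl⟩ | ⟨rfl, rfl⟩) n hr
    · exact d2 n hr
    · exact d2 n hr.symm
  have osymm : ∀ c d, opp c d → opp d c := by
    rintro c d (⟨rfl, rfl⟩ | ⟨rfl, rfl⟩)
    · exact Or.inr ⟨rfl, rfl⟩
    · exact Or.inl ⟨rfl, rfl⟩
  have ouniq : ∀ c d e, opp c d → opp e d → e = c ∨ (e = d ∧ c = d) := by
    rintro c d e (⟨rfl, rfl⟩ | ⟨rfl, rfl⟩) (⟨rfl, h'⟩ | ⟨rfl, h'⟩) <;> simp_all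
  let K := del H1 x y
  let Good : W → ℕ → Prop := fun z L => (∃ n, n ≤ L ∧ Rch K x n z) ∨
    ∃ c d s t, opp c d ∧ Rch K x s c ∧ Rch K d t z ∧ s + t + h ≤ L
  have gmono : ∀ z L L', L ≤ L' → Good z L → Good z L' := by
    rintro z L L' hL (⟨n, hn, hr⟩ | ⟨c, d, s, t, ho, hs, ht, hl⟩)
    · exact Or.inl ⟨n, hn.trans hL, hr⟩
    · exact Or.inr ⟨c, d, s, t, ho, hs, ht, hl.trans hL⟩
  have jump : ∀ c d L, opp c d → Good c L → Good d (L + h) := by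
    rintro c d L ho (⟨n, hn, hr⟩ | ⟨c', d', s, t, ho', hs, ht, hl⟩)
    · exact Or.inr ⟨c, d, n, 0, ho, hr, Rch.nil, by omega⟩
    · by_cases hc : c' = d
      · subst hc
        exact Or.inl ⟨s, by omega, hs⟩
      · have hc' : c' = c := by
          rcases ho with ⟨rfl, rfl⟩ | ⟨rfl, rfl⟩ <;> rcases ho' with ⟨rfl, rfl⟩ | ⟨rfl, rfl⟩ <;>
            simp_all
        subst hc'
        exact Or.inr ⟨c', d, s, 0, ho, hs, Rch.nil, by omega⟩
  have key : ∀ L z, Rch (del (H1 ⊔ H2) x y) x L z → (z ∈ S1 ∨ z ∈ S2) ∧ (z ∈ S1 → Good z L) ∧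
      (z ∈ S2 → ∃ c L1 L2, (c = a ∨ c = b) ∧ L1 + L2 ≤ L ∧ Good c L1 ∧ Rch H2 c L2 z) := by
    intro L z hr
    induction hr with
    | nil =>
      have hx := h1 _ _ hxy
      have hg : Good x 0 := Or.inl ⟨0, le_rfl, Rch.nil⟩
      exact ⟨Or.inl hx, fun _ => hg, fun hx2 => ⟨x, 0, 0, hS x hx hx2, le_rfl, hg, Rch.nil⟩⟩
    | @snoc L z z' _ hadj ih =>
      obtain ⟨_, ih1, ih2⟩ := ih
      rw [del_adj] at hadj
      obtain ⟨hadj, hne⟩ := hadj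
      rcases hadj with hadj | hadj
      · have hz := h1 _ _ hadj
        have hz' := h1 _ _ hadj.symm
        have hK : K.Adj z z' := del_adj.2 ⟨hadj, hne⟩
        have hg : Good z' (L + 1) := by
          rcases ih1 hz with ⟨n, hn, hr⟩ | ⟨c, d, s, t, ho, hs, ht, hl⟩
          · exact Or.inl ⟨n + 1, by omega, hr.snoc hK⟩
          · exact Or.inr ⟨c, d, s, t + 1, ho, hs, ht.snoc hK, by omega⟩
        exact ⟨Or.inl hz', fun _ => hg,
          fun hz2 => ⟨z', L + 1, 0, hS _ hz' hz2, by omega, hg, Rch.nil⟩⟩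
      · have hz := h2 _ _ hadj
        have hz' := h2 _ _ hadj.symm
        obtain ⟨c, L1, L2, hc, hL, hgood, hr⟩ := ih2 hz
        have hr' := hr.snoc hadj
        refine ⟨Or.inr hz', ?_, fun _ => ⟨c, L1, L2 + 1, hc, by omega, hgood, hr'⟩⟩
        intro hz1
        by_cases hcz : c = z'
        · subst hcz
          exact gmono _ _ _ (by omega) hgood
        · have ho : opp c z' := by
            rcases hc with rfl | rfl <;> rcases hS _ hz1 hz' with h' | h'
            · exact absurd h'.symm hcz
            · exact Or.inl ⟨rfl, h'⟩
            · exact Or.inr ⟨rfl, h'⟩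
            · exact absurd h'.symm hcz
          have := od2 _ _ ho _ hr'
          exact gmono _ _ _ (by omega) (jump _ _ _ ho hgood)
  rcases (key n y hn).2.1 (h1 _ _ hxy.symm) with ⟨n', hn', hr⟩ | ⟨c, d, s, t, ho, hs, ht, hl⟩
  · have := gb1 x y hxy n' hr
    omega
  · have hle : K ≤ H1 := del_le
    have := od1 _ _ ho _ (((hs.mono hle).symm.snoc hxy).trans (ht.mono hle).symm)
    omega

theorem glue (H1 H2 : SimpleGraph W) (S1 S2 : Set W) (a b : W) (g h : ℕ)
    (h1 : ∀ u v, H1.Adj u v → u ∈ S1) (h2 : ∀ u v, H2.Adj u v → u ∈ S2)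
    (hS : ∀ w, w ∈ S1 → w ∈ S2 → w = a ∨ w = b)
    (gb1 : GB H1 g) (gb2 : GB H2 g)
    (d1 : ∀ n, Rch H1 a n b → h ≤ n) (d2 : ∀ n, Rch H2 a n b → h ≤ n) (hgh : g ≤ 2 * h) :
    GB (H1 ⊔ H2) g := by
  intro x y hxy n hn
  rcases hxy with hxy | hxy
  · exact glue_aux H1 H2 S1 S2 a b g h h1 h2 hS gb1 d1 d2 hgh x y hxy n hn
  · rw [sup_comm] at hn
    exact glue_aux H2 H1 S2 S1 a b g h h2 h1 (fun w hw hw' => hS w hw' hw) gb2 d2 d1 hgh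
      x y hxy n hn

theorem glue_dist (H1 H2 : SimpleGraph W) (S1 S2 : Set W) (a b : W) (h : ℕ)
    (h1 : ∀ u v, H1.Adj u v → u ∈ S1) (h2 : ∀ u v, H2.Adj u v → u ∈ S2)
    (ha1 : a ∈ S1) (hab : a ≠ b)
    (hS : ∀ w, w ∈ S1 → w ∈ S2 → w = a ∨ w = b)
    (d1 : ∀ n, Rch H1 a n b → h ≤ n) (d2 : ∀ n, Rch H2 a n b → h ≤ n) :
    ∀ n, Rch (H1 ⊔ H2) a n b → h ≤ n := by
  have key : ∀ L z, Rch (H1 ⊔ H2) a L z → h ≤ L ∨ (z ≠ b ∧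
      (z ∈ S1 → ∃ n, n ≤ L ∧ Rch H1 a n z) ∧ (z ∈ S2 → ∃ n, n ≤ L ∧ Rch H2 a n z)) := by
    intro L z hr
    induction hr with
    | nil => exact Or.inr ⟨hab, fun _ => ⟨0, le_rfl, Rch.nil⟩, fun _ => ⟨0, le_rfl, Rch.nil⟩⟩
    | @snoc L z z' _ hadj ih =>
      rcases ih with ih | ⟨_, ih1, ih2⟩
      · exact Or.inl (by omega)
      rcases hadj with hadj | hadj
      · obtain ⟨n, hn, hr⟩ := ih1 (h1 _ _ hadj)
        have hr' := hr.snoc hadj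
        by_cases hz : z' = b
        · subst hz
          have := d1 _ hr'
          exact Or.inl (by omega)
        · refine Or.inr ⟨hz, fun _ => ⟨n + 1, by omega, hr'⟩, fun hz2 => ?_⟩
          rcases hS _ (h1 _ _ hadj.symm) hz2 with rfl | rfl
          · exact ⟨0, by omega, Rch.nil⟩
          · exact absurd rfl hz
      · obtain ⟨n, hn, hr⟩ := ih2 (h2 _ _ hadj)
        have hr' := hr.snoc hadj
        by_cases hz : z' = b
        · subst hz
          have := d2 _ hr'
          exact Or.inl (by omega)
        · refine Or.inr ⟨hz, fun hz1 => ?_, fun _ => ⟨n + 1, by omega, hr'⟩⟩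
          rcases hS _ hz1 (h2 _ _ hadj.symm) with rfl | rfl
          · exact ⟨0, by omega, Rch.nil⟩
          · exact absurd rfl hz
  intro n hn
  rcases key n b hn with hh | hh
  · exact hh
  · exact absurd rfl hh.1

/-- Two-terminal pieces. -/
structure Piece (V : Type u) (G : SimpleGraph V) (a b : V) (g h d N : ℕ) : Prop where
  fin : Finite V
  ne : a ≠ b
  gb : GB G g
  dist : ∀ n, Rch G a n b → h ≤ n
  dega : (G.neighborSet a).ncard = d
  degb : (G.neighborSet b).ncard = d
  deg : ∀ v, v ≠ a → v ≠ b → (G.neighborSet v).ncard = 3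
  card : Nat.card V = N + 2

theorem exists_emb {V1 V2 : Type u} {a1 b1 : V1} {a2 b2 : V2} (h1 : a1 ≠ b1) (h2 : a2 ≠ b2)
    (f1 : V1 ↪ V1 ⊕ {x : V2 // ¬ (x = a2 ∨ x = b2)}) (hf1 : ∀ x, f1 x = Sum.inl x) :
    ∃ f2 : V2 ↪ V1 ⊕ {x : V2 // ¬ (x = a2 ∨ x = b2)}, f2 a2 = f1 a1 ∧ f2 b2 = f1 b1 ∧
      (∀ x y, f1 x = f2 y → (x = a1 ∧ y = a2) ∨ (x = b1 ∧ y = b2)) ∧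
      (∀ w, (∃ x, f1 x = w) ∨ ∃ y, y ≠ a2 ∧ y ≠ b2 ∧ f2 y = w) := by
  classical
  obtain ⟨F, hF⟩ : ∃ F : V2 → V1 ⊕ {x : V2 // ¬ (x = a2 ∨ x = b2)}, F = fun x =>
    if h : (x = a2 ∨ x = b2) then (if x = a2 then Sum.inl a1 else Sum.inl b1)
    else Sum.inr ⟨x, h⟩ := ⟨_, rfl⟩
  have Fa : F a2 = Sum.inl a1 := by rw [hF]; simp
  have Fb : F b2 = Sum.inl b1 := by rw [hF]; simp [h2.symm]
  have Fc : ∀ x (h : ¬ (x = a2 ∨ x = b2)), F x = Sum.inr ⟨x, h⟩ := by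
    intro x h
    rw [hF]
    exact dif_neg h
  have cases3 : ∀ x, x = a2 ∨ x = b2 ∨ ¬ (x = a2 ∨ x = b2) := by
    intro x
    tauto
  have inj : Function.Injective F := by
    intro x y hxy
    rcases cases3 x with rfl | rfl | hx <;> rcases cases3 y with rfl | rfl | hy
    · rfl
    · rw [Fa, Fb] at hxy
      exact absurd (Sum.inl_injective hxy) h1
    · rw [Fa, Fc y hy] at hxy
      cases hxy
    · rw [Fa, Fb] at hxy
      exact absurd (Sum.inl_injective hxy).symm h1
    · rfl
    · rw [Fb, Fc y hy] at hxy
      cases hxy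
    · rw [Fa, Fc x hx] at hxy
      cases hxy
    · rw [Fb, Fc x hx] at hxy
      cases hxy
    · rw [Fc x hx, Fc y hy] at hxy
      exact congrArg Subtype.val (Sum.inr_injective hxy)
  refine ⟨⟨F, inj⟩, by rw [hf1]; exact Fa, by rw [hf1]; exact Fb, ?_, ?_⟩
  · intro x y hxy
    rw [hf1] at hxy
    change _ = F y at hxy
    rcases cases3 y with rfl | rfl | hy
    · rw [Fa] at hxy
      exact Or.inl ⟨Sum.inl_injective hxy, rfl⟩
    · rw [Fb] at hxy
      exact Or.inr ⟨Sum.inl_injective hxy, rfl⟩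
    · rw [Fc y hy] at hxy
      cases hxy
  · rintro (x | ⟨y, hy⟩)
    · exact Or.inl ⟨x, hf1 x⟩
    · exact Or.inr ⟨y, fun h => hy (Or.inl h), fun h => hy (Or.inr h), Fc y hy⟩

theorem glue_pieces {V1 V2 : Type u} {G1 : SimpleGraph V1} {G2 : SimpleGraph V2} {a1 b1 : V1}
    {a2 b2 : V2} {g h d1 d2 N1 N2 : ℕ} (hgh : g ≤ 2 * h) (hh : 2 ≤ h)
    (P1 : Piece V1 G1 a1 b1 g h d1 N1) (P2 : Piece V2 G2 a2 b2 g h d2 N2) :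
    ∃ (W : Type u) (H : SimpleGraph W) (a b : W), Piece W H a b g h (d1 + d2) (N1 + N2) ∧
      (HasCyc G1 g → HasCyc H g) := by
  classical
  have := P1.fin
  have := P2.fin
  let W := V1 ⊕ {x : V2 // ¬ (x = a2 ∨ x = b2)}
  let f1 : V1 ↪ W := ⟨Sum.inl, Sum.inl_injective⟩
  obtain ⟨f2, ha, hb, hmeet, hcov⟩ := exists_emb P1.ne P2.ne f1 (fun _ => rfl)
  have s1 : ∀ u v, (G1.map f1).Adj u v → u ∈ Set.range f1 := by
    intro u v huv
    rw [SimpleGraph.map_adj] at huv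
    obtain ⟨u, v, _, rfl, rfl⟩ := huv
    exact ⟨u, rfl⟩
  have s2 : ∀ u v, (G2.map f2).Adj u v → u ∈ Set.range f2 := by
    intro u v huv
    rw [SimpleGraph.map_adj] at huv
    obtain ⟨u, v, _, rfl, rfl⟩ := huv
    exact ⟨u, rfl⟩
  have hS : ∀ w, w ∈ Set.range f1 → w ∈ Set.range f2 → w = f1 a1 ∨ w = f1 b1 := by
    rintro _ ⟨x, rfl⟩ ⟨y, hy⟩
    rcases hmeet x y hy.symm with ⟨rfl, _⟩ | ⟨rfl, _⟩
    · exact Or.inl rfl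
    · exact Or.inr rfl
  have e1 : ∀ n, Rch (G1.map f1) (f1 a1) n (f1 b1) → h ≤ n :=
    fun n hn => P1.dist n (hn.of_map')
  have e2 : ∀ n, Rch (G2.map f2) (f1 a1) n (f1 b1) → h ≤ n := by
    intro n hn
    rw [← ha, ← hb] at hn
    exact P2.dist n (hn.of_map')
  have hne : f1 a1 ≠ f1 b1 := fun h => P1.ne (f1.injective h)
  have nsup : ∀ w, ((G1.map f1) ⊔ (G2.map f2)).neighborSet w =
      (G1.map f1).neighborSet w ∪ (G2.map f2).neighborSet w := by
    intro w
    ext z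
    simp [mem_neighborSet]
  have dist' := glue_dist (G1.map f1) (G2.map f2) _ _ _ _ h s1 s2 ⟨a1, rfl⟩ hne hS e1 e2
  have disj : ∀ w, w = f1 a1 ∨ w = f1 b1 →
      Disjoint ((G1.map f1).neighborSet w) ((G2.map f2).neighborSet w) := by
    intro w hw
    rw [Set.disjoint_left]
    intro z hz1 hz2
    rw [mem_neighborSet] at hz1 hz2
    have hz := hS z (s1 _ _ hz1.symm) (s2 _ _ hz2.symm)
    rcases hw with rfl | rfl <;> rcases hz with rfl | rfl
    · exact hz1.ne rfl
    · have := e1 _ (Rch.nil.snoc hz1)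
      omega
    · have := e1 _ (Rch.nil.snoc hz1.symm)
      omega
    · exact hz1.ne rfl
  have : Finite W := inferInstance
  refine ⟨W, (G1.map f1) ⊔ (G2.map f2), f1 a1, f1 b1, ⟨inferInstance, hne,
    glue _ _ _ _ _ _ g h s1 s2 hS (P1.gb.map f1) (P2.gb.map f2) e1 e2 hgh, dist', ?_, ?_, ?_, ?_⟩,
    fun hc => (hc.map f1).mono le_sup_left⟩
  · rw [nsup, Set.ncard_union_eq (disj _ (Or.inl rfl)) (Set.toFinite _) (Set.toFinite _),
      ncard_map, ← ha, ncard_map, P1.dega, P2.dega]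
  · rw [nsup, Set.ncard_union_eq (disj _ (Or.inr rfl)) (Set.toFinite _) (Set.toFinite _),
      ncard_map, ← hb, ncard_map, P1.degb, P2.degb]
  · intro w hwa hwb
    rw [nsup]
    rcases hcov w with ⟨x, rfl⟩ | ⟨y, hya, hyb, rfl⟩
    · rw [nbr_map_empty G2 f2, Set.union_empty, ncard_map]
      · exact P1.deg x (fun h => hwa (by rw [h])) (fun h => hwb (by rw [h]))
      · intro y hy
        rcases hmeet x y hy.symm with ⟨rfl, _⟩ | ⟨rfl, _⟩
        · exact hwa rfl
        · exact hwb rfl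
    · rw [nbr_map_empty G1 f1, Set.empty_union, ncard_map]
      · exact P2.deg y hya hyb
      · intro x hx
        rcases hmeet x y hx with ⟨_, rfl⟩ | ⟨_, rfl⟩
        · exact hya rfl
        · exact hyb rfl
  · have hc1 := P1.card
    have hc2 := P2.card
    have hc3 : Nat.card {x : V2 // ¬ (x = a2 ∨ x = b2)} = N2 := by
      have h1 : Nat.card {x : V2 // (x = a2 ∨ x = b2)} = 2 := by
        have : Nat.card ({a2, b2} : Set V2) = 2 := by
          rw [Nat.card_coe_set_eq, Set.ncard_pair P2.ne]
        exact this
      have h2 := Nat.card_congr (Equiv.sumCompl (fun x : V2 => x = a2 ∨ x = b2))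
      rw [Nat.card_sum] at h2
      omega
    change Nat.card (V1 ⊕ {x : V2 // ¬ (x = a2 ∨ x = b2)}) = _
    rw [Nat.card_sum]
    omega

/-- The `k`-fold gluing. -/
theorem glue_many {V : Type u} {G : SimpleGraph V} {a b : V} {g h d N : ℕ}
    (hgh : g ≤ 2 * h) (hh : 2 ≤ h) (P : Piece V G a b g h d N) (hc : HasCyc G g) (k : ℕ)
    (hk : 1 ≤ k) :
    ∃ (W : Type u) (H : SimpleGraph W) (a b : W), Piece W H a b g h (d * k) (k * N) ∧
      HasCyc H g := by
  induction k, hk using Nat.le_induction with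
  | base => exact ⟨V, G, a, b, by simpa using P, hc⟩
  | succ k hk ih =>
    obtain ⟨W, H, a', b', PH, hH⟩ := ih
    obtain ⟨W', H', a'', b'', PH', hH'⟩ := glue_pieces hgh hh PH P
    refine ⟨W', H', a'', b'', ?_, hH' hH⟩
    have e1 : d * (k + 1) = d * k + d := by ring
    have e2 : (k + 1) * N = k * N + N := by ring
    rw [e1, e2]
    exact PH'

theorem nbr_del_left {G : SimpleGraph V} {x y : V} :
    (del G x y).neighborSet x = G.neighborSet x \ {y} := by
  ext z
  simp only [mem_neighborSet, del_adj, Set.mem_sdiff, Set.mem_singleton_iff]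
  constructor
  · rintro ⟨h, h'⟩
    exact ⟨h, fun e => h' (by simp [e])⟩
  · rintro ⟨h, h'⟩
    refine ⟨h, ?_⟩
    rintro (⟨_, e⟩ | ⟨_, e⟩)
    · exact h' e
    · exact h.ne e.symm

theorem del_comm {G : SimpleGraph V} {x y : V} : del G x y = del G y x := by
  rw [del, del, Sym2.eq_swap]

theorem nbr_del_ne {G : SimpleGraph V} {x y v : V} (hx : v ≠ x) (hy : v ≠ y) :
    (del G x y).neighborSet v = G.neighborSet v := by
  ext z
  simp [mem_neighborSet, del_adj, hx, hy]

theorem piece_two [Finite V] {G : SimpleGraph V} {g h N : ℕ} (hg : h + 1 ≤ g)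
    (hreg : ∀ v : V, (G.neighborSet v).ncard = 3) (gb : GB G g) (hN : Nat.card V = N + 2)
    {x y : V} (hxy : G.Adj x y) : Piece V (del G x y) x y g h 2 N where
  fin := inferInstance
  ne := hxy.ne
  gb := gb.mono del_le
  dist := fun n hn => by have := gb x y hxy n hn; omega
  dega := by
    rw [nbr_del_left, Set.ncard_sdiff_singleton_of_mem (by exact hxy), hreg]
  degb := by
    rw [del_comm, nbr_del_left, Set.ncard_sdiff_singleton_of_mem (by exact hxy.symm), hreg]
  deg := fun v hx hy => by rw [nbr_del_ne hx hy, hreg]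
  card := hN

/-- Two pendant edges. -/
def pend (x y : V) : SimpleGraph (V ⊕ Bool) where
  Adj u v := (u = Sum.inl x ∧ v = Sum.inr true) ∨ (u = Sum.inr true ∧ v = Sum.inl x) ∨
    (u = Sum.inl y ∧ v = Sum.inr false) ∨ (u = Sum.inr false ∧ v = Sum.inl y)
  symm := ⟨by intro u v h; tauto⟩
  loopless := ⟨by intro u h; rcases h with ⟨rfl, h⟩ | ⟨rfl, h⟩ | ⟨rfl, h⟩ | ⟨rfl, h⟩ <;> simp at h⟩

theorem piece_one [Finite V] {G : SimpleGraph V} {g h N : ℕ} (hg : h + 1 ≤ g) (hgh : g ≤ 2 * h)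
    (hreg : ∀ v : V, (G.neighborSet v).ncard = 3) (gb : GB G g) (hN : Nat.card V = N)
    {x y : V} (hxy : G.Adj x y) :
    ∃ (H : SimpleGraph (V ⊕ Bool)) (a b : V ⊕ Bool), Piece (V ⊕ Bool) H a b g h 1 N := by
  classical
  let f : V ↪ V ⊕ Bool := ⟨Sum.inl, Sum.inl_injective⟩
  have hne := hxy.ne
  have hnbr : ∀ u, ((del G x y).map f ⊔ pend x y).neighborSet u =
      ((del G x y).map f).neighborSet u ∪ (pend x y).neighborSet u := by
    intro w
    ext z
    simp [mem_neighborSet]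
  have hinr : ∀ c, ((del G x y).map f).neighborSet (Sum.inr c) = ∅ := by
    intro c
    apply nbr_map_empty
    intro v hv
    cases hv
  have hinl : ∀ v, ((del G x y).map f).neighborSet (Sum.inl v) =
      Sum.inl '' (del G x y).neighborSet v := fun v => nbr_map _ f v
  have pstay : ∀ n z, Rch (pend x y) (Sum.inl x) n z → z = Sum.inl x ∨ z = Sum.inr true := by
    intro n z hz
    induction hz with
    | nil => exact Or.inl rfl
    | snoc _ ha ih =>
      rcases ih with rfl | rfl <;> rcases ha with ⟨h1, h2⟩ | ⟨h1, h2⟩ | ⟨h1, h2⟩ | ⟨h1, h2⟩ <;>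
        simp_all
  have isol : ∀ (K : SimpleGraph (V ⊕ Bool)) (u v : V ⊕ Bool), (∀ w, ¬ K.Adj w v) → u ≠ v →
      ∀ n, ¬ Rch K u n v := by
    intro K u v hv huv n hn
    cases hn with
    | nil => exact huv rfl
    | snoc _ ha => exact hv _ ha
  have gbp : GB (pend x y) g := by
    intro u v huv n hn
    exfalso
    rcases huv with ⟨rfl, rfl⟩ | ⟨rfl, rfl⟩ | ⟨rfl, rfl⟩ | ⟨rfl, rfl⟩
    · refine isol _ _ _ ?_ (by simp) _ hn
      intro w hw
      rw [del_adj] at hw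
      obtain ⟨hw, hw'⟩ := hw
      simp [pend] at hw
      exact hw' (Or.inl ⟨hw, rfl⟩)
    · refine isol _ _ _ ?_ (by simp) _ hn.symm
      intro w hw
      rw [del_adj] at hw
      obtain ⟨hw, hw'⟩ := hw
      simp [pend] at hw
      exact hw' (Or.inr ⟨hw, rfl⟩)
    · refine isol _ _ _ ?_ (by simp) _ hn
      intro w hw
      rw [del_adj] at hw
      obtain ⟨hw, hw'⟩ := hw
      simp [pend] at hw
      exact hw' (Or.inl ⟨hw, rfl⟩)
    · refine isol _ _ _ ?_ (by simp) _ hn.symm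
      intro w hw
      rw [del_adj] at hw
      obtain ⟨hw, hw'⟩ := hw
      simp [pend] at hw
      exact hw' (Or.inr ⟨hw, rfl⟩)
  have gbH : GB ((del G x y).map f ⊔ pend x y) g := by
    refine glue _ _ (Set.range Sum.inl) {z | ∃ w, (pend x y).Adj z w} (Sum.inl x) (Sum.inl y) g h
      ?_ ?_ ?_ ((gb.mono del_le).map f) gbp ?_ ?_ hgh
    · intro u v huv
      rw [SimpleGraph.map_adj] at huv
      obtain ⟨u, v, _, rfl, rfl⟩ := huv
      exact ⟨u, rfl⟩
    · intro u v huv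
      exact ⟨v, huv⟩
    · rintro _ ⟨u, rfl⟩ ⟨w, hw⟩
      simp [pend] at hw
      simp
      tauto
    · intro n hn
      have := gb x y hxy n (Rch.of_map' f hn)
      omega
    · intro n hn
      have := pstay _ _ hn
      simp at this
      exact absurd this.symm hne
  have dkey : ∀ n z, Rch ((del G x y).map f ⊔ pend x y) (Sum.inr true) n z →
      (z = Sum.inr true) ∨ (z = Sum.inr false ∧ ∃ m, m ≤ n ∧ Rch (del G x y) x m y) ∨
      (∃ v m, z = Sum.inl v ∧ m ≤ n ∧ Rch (del G x y) x m v) := by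
    intro n z hz
    induction hz with
    | nil => exact Or.inl rfl
    | @snoc n u w _ ha ih =>
      rcases ha with ha | ha
      · rw [SimpleGraph.map_adj] at ha
        obtain ⟨u, w, ha, rfl, rfl⟩ := ha
        rcases ih with ih | ⟨ih, _⟩ | ⟨v, m, hv, hm, hr⟩
        · cases ih
        · cases ih
        · cases hv
          exact Or.inr (Or.inr ⟨w, m + 1, rfl, by omega, hr.snoc ha⟩)
      · rcases ha with ⟨rfl, rfl⟩ | ⟨rfl, rfl⟩ | ⟨rfl, rfl⟩ | ⟨rfl, rfl⟩
        · exact Or.inl rfl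
        · exact Or.inr (Or.inr ⟨x, 0, rfl, by omega, Rch.nil⟩)
        · rcases ih with ih | ⟨ih, _⟩ | ⟨v, m, hv, hm, hr⟩
          · cases ih
          · cases ih
          · cases hv
            exact Or.inr (Or.inl ⟨rfl, m, by omega, hr⟩)
        · rcases ih with ih | ⟨_, m, hm, hr⟩ | ⟨v, m, hv, hm, hr⟩
          · cases ih
          · exact Or.inr (Or.inr ⟨y, m, rfl, by omega, hr⟩)
          · cases hv
  refine ⟨(del G x y).map f ⊔ pend x y, Sum.inr true, Sum.inr false,
    ⟨inferInstance, by simp, gbH, ?_, ?_, ?_, ?_, ?_⟩⟩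
  · intro n hn
    rcases dkey _ _ hn with h' | ⟨_, m, hm, hr⟩ | ⟨v, m, hv, _⟩
    · cases h'
    · have := gb _ _ hxy _ hr
      omega
    · cases hv
  · have : (pend x y).neighborSet (Sum.inr true) = {Sum.inl x} := by
      ext z; simp [pend, mem_neighborSet]
    rw [hnbr, hinr, Set.empty_union, this, Set.ncard_singleton]
  · have : (pend x y).neighborSet (Sum.inr false) = {Sum.inl y} := by
      ext z; simp [pend, mem_neighborSet]
    rw [hnbr, hinr, Set.empty_union, this, Set.ncard_singleton]
  · rintro (v | (_ | _)) h1 h2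
    · rw [hnbr, hinl]
      by_cases hx : v = x
      · subst hx
        have : (pend v y).neighborSet (Sum.inl v) = {Sum.inr true} := by
          ext z; simp [pend, mem_neighborSet, hne]
        rw [this, Set.ncard_union_eq (by simp) (Set.toFinite _) (Set.toFinite _),
          Set.ncard_image_of_injective _ Sum.inl_injective, nbr_del_left,
          Set.ncard_sdiff_singleton_of_mem (by exact hxy), hreg, Set.ncard_singleton]
      · by_cases hy : v = y
        · subst hy
          have : (pend x v).neighborSet (Sum.inl v) = {Sum.inr false} := by
            ext z; simp [pend, mem_neighborSet, hne.symm]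
          rw [this, Set.ncard_union_eq (by simp) (Set.toFinite _) (Set.toFinite _),
            Set.ncard_image_of_injective _ Sum.inl_injective, del_comm, nbr_del_left,
            Set.ncard_sdiff_singleton_of_mem (by exact hxy.symm), hreg, Set.ncard_singleton]
        · have : (pend x y).neighborSet (Sum.inl v) = ∅ := by
            ext z; simp [pend, mem_neighborSet, hx, hy]
          rw [this, Set.union_empty, Set.ncard_image_of_injective _ Sum.inl_injective,
            nbr_del_ne hx hy, hreg]
    · exact absurd rfl h2
    · exact absurd rfl h1
  · rw [Nat.card_sum, hN]
    simp

theorem finish {V : Type u} {G : SimpleGraph V} {a b : V} {g h m N : ℕ} (hh : 2 ≤ h)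
    (hm : 3 < m) (P : Piece V G a b g h m N) (hc : HasCyc G g) :
    ∃ (W : Type) (_ : Finite W) (H : SimpleGraph W),
      H.egirth = g ∧
      (∀ w : W, (H.neighborSet w).ncard = 3 ∨ (H.neighborSet w).ncard = m) ∧
      (∃ w : W, (H.neighborSet w).ncard = 3) ∧
      (∃ w : W, (H.neighborSet w).ncard = m) ∧
      Nat.card W = N + 2 := by
  have := P.fin
  obtain ⟨e⟩ : Nonempty (V ≃ Fin (N + 2)) := ⟨Finite.equivFinOfCardEq P.card⟩
  let f : V ↪ Fin (N + 2) := e.toEmbedding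
  have hf : ∀ w, ∃ v, f v = w := fun w => ⟨e.symm w, e.apply_symm_apply w⟩
  refine ⟨Fin (N + 2), inferInstance, G.map f, ?_, ?_, ?_, ⟨f a, by rw [ncard_map, P.dega]⟩,
    by simp⟩
  · apply le_antisymm
    · obtain ⟨v, p, hp, hl⟩ := hc.map f
      rw [← hl]
      exact (SimpleGraph.le_egirth.1 le_rfl) _ _ hp
    · exact (P.gb.map f).le_egirth
  · intro w
    obtain ⟨v, rfl⟩ := hf w
    rw [ncard_map]
    by_cases ha : v = a
    · rw [ha]; exact Or.inr P.dega
    · by_cases hb : v = b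
      · rw [hb]; exact Or.inr P.degb
      · exact Or.inl (P.deg v ha hb)
  · have hne : (G.neighborSet a).Nonempty := by
      apply Set.nonempty_of_ncard_ne_zero
      rw [P.dega]
      omega
    obtain ⟨v, hv⟩ := hne
    rw [mem_neighborSet] at hv
    refine ⟨f v, ?_⟩
    rw [ncard_map]
    refine P.deg v hv.ne.symm ?_
    rintro rfl
    have := P.dist _ (Rch.nil.snoc hv)
    omega

end Glue

open Glue in
/-- Let `g ≥ 6` be even and `G` a finite simple 3-regular graph of girth `g` on `n`
vertices containing two vertices at distance `g/2`. Let `m = 3k + t` with `k ≥ 1`, `t ∈ {0,1,2}`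
and `m > 3`. Then there is a finite simple graph of girth exactly `g` whose degrees are `3` and
`m` (both occurring) and whose order is `k(n-2) + 2` if `t = 0`, `k(n-2) + n + 2` if `t = 1`,
and `k(n-2) + n` if `t = 2`. -/
theorem stmt_8 {V : Type*} [Fintype V] (g k t m n : ℕ)
    (hg6 : 6 ≤ g) (hgeven : Even g) (hk : 1 ≤ k) (ht : t < 3) (hm : m = 3 * k + t) (hm3 : 3 < m)
    (G : SimpleGraph V) (hcard : Fintype.card V = n)
    (hreg : ∀ v : V, (G.neighborSet v).ncard = 3)
    (hgirth : G.egirth = g)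
    (hremote : ∃ u v : V, u ≠ v ∧ G.dist u v = g / 2) :
    ∃ (W : Type) (_ : Finite W) (H : SimpleGraph W),
      H.egirth = g ∧
      (∀ w : W, (H.neighborSet w).ncard = 3 ∨ (H.neighborSet w).ncard = m) ∧
      (∃ w : W, (H.neighborSet w).ncard = 3) ∧
      (∃ w : W, (H.neighborSet w).ncard = m) ∧
      Nat.card W = k * (n - 2) + (if t = 0 then 2 else if t = 1 then n + 2 else n) := by
  obtain ⟨a, b, hab, hd⟩ := hremote
  obtain ⟨h, rfl⟩ := hgeven
  have hd' : G.dist a b = h := by omega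
  have gb : GB G (h + h) := GB.of_le_egirth hgirth.ge
  have hn2 : 2 ≤ n := by
    rw [← hcard]
    exact Fintype.one_lt_card_iff.2 ⟨a, b, hab⟩
  have hc : HasCyc G (h + h) := by
    have hna : ¬ G.IsAcyclic := by
      rw [← SimpleGraph.egirth_eq_top, hgirth]
      exact ENat.natCast_ne_top _
    obtain ⟨v, p, hp, hl⟩ := SimpleGraph.exists_egirth_eq_length.2 hna
    refine ⟨v, p, hp, ?_⟩
    rw [hgirth] at hl
    exact_mod_cast hl.symm
  have hcard' : Nat.card V = (n - 2) + 2 := by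
    rw [Nat.card_eq_fintype_card]; omega
  have P : Piece V G a b (h + h) h 3 (n - 2) :=
    ⟨inferInstance, hab, gb, fun l hl => by
      obtain ⟨p, hp⟩ := hl.exists_walk
      have := SimpleGraph.dist_le p
      omega, hreg a, hreg b, fun v _ _ => hreg v, hcard'⟩
  obtain ⟨y, hy⟩ : (G.neighborSet a).Nonempty := by
    apply Set.nonempty_of_ncard_ne_zero
    rw [hreg]
    omega
  have hay : G.Adj a y := hy
  obtain ⟨W, H, c, d, PH, hH⟩ := glue_many (by omega) (by omega) P hc k hk
  obtain rfl | rfl | rfl : t = 0 ∨ t = 1 ∨ t = 2 := by omega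
  · have := finish (m := m) (h := h) (by omega) hm3 (by rw [hm]; exact PH) hH
    simpa using this
  · obtain ⟨H1, a1, b1, P1⟩ := piece_one (h := h) (by omega) (by omega) hreg gb rfl hay
    obtain ⟨W', H', a', b', PH', hH'⟩ := glue_pieces (by omega) (by omega) PH P1
    have := finish (m := m) (h := h) (by omega) hm3 (by rw [hm]; exact PH') (hH' hH)
    have e : k * (n - 2) + Nat.card V + 2 = k * (n - 2) + (n + 2) := by omega
    rw [e] at this
    simpa using this
  · have P2 := piece_two (h := h) (by omega) hreg gb hcard' hay
    obtain ⟨W', H', a', b', PH', hH'⟩ := glue_pieces (by omega) (by omega) PH P2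
    have := finish (m := m) (h := h) (by omega) hm3 (by rw [hm]; exact PH') (hH' hH)
    have e : k * (n - 2) + (n - 2) + 2 = k * (n - 2) + n := by omega
    rw [e] at this
    simpa using this
end

section
/- Let 2 ≤ r < m be integers and let 3 ≤ g1 ≤ g2 be integers. If there exists an ({r,m};g2)-graph on n vertices, then there exists an ({r,m};g1)-graph on at most n vertices. Consequently, n({r,m};g1) ≤ n({r,m};g2), where n({r,m};g) denotes the minimum number of vertices of an ({r,m};g)-graph. -/
/-- `G` is an `({r,m};g)`-graph: a finite simple graph of girth `g` in which every vertex has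
degree `r` or degree `m` and both degrees occur. -/
def IsBiregGirthGraph (r m g : ℕ) {V : Type*} (G : SimpleGraph V) : Prop :=
  G.egirth = g ∧
  (∀ v : V, (G.neighborSet v).ncard = r ∨ (G.neighborSet v).ncard = m) ∧
  (∃ v : V, (G.neighborSet v).ncard = r) ∧
  (∃ v : V, (G.neighborSet v).ncard = m)

/-- `n({r,m};g)`: the minimum order of an `({r,m};g)`-graph. -/
noncomputable def nBireg (r m g : ℕ) : ℕ :=
  sInf {n : ℕ | ∃ G : SimpleGraph (Fin n), IsBiregGirthGraph r m g G}

namespace BiregMono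
open SimpleGraph

universe u
variable {V : Type u}

/-- Splitting a trail at one of its edges. -/
lemma trail_split {G : SimpleGraph V} {x y : V} : ∀ {s t : V} (p : G.Walk s t), p.edges.Nodup →
    s(x, y) ∈ p.edges →
    (∃ (p₁ : G.Walk s x) (p₂ : G.Walk y t), p₁.edges ⊆ p.edges ∧ p₂.edges ⊆ p.edges ∧
      s(x, y) ∉ p₁.edges ∧ s(x, y) ∉ p₂.edges ∧ p₁.length + p₂.length + 1 = p.length) ∨
    (∃ (p₁ : G.Walk s y) (p₂ : G.Walk x t), p₁.edges ⊆ p.edges ∧ p₂.edges ⊆ p.edges ∧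
      s(x, y) ∉ p₁.edges ∧ s(x, y) ∉ p₂.edges ∧ p₁.length + p₂.length + 1 = p.length) := by
  intro s t p
  induction p with
  | nil => intro _ h; simp at h
  | @cons s w t hsw p ih =>
    intro hnd hmem
    rw [Walk.edges_cons, List.nodup_cons] at hnd
    rw [Walk.edges_cons, List.mem_cons] at hmem
    by_cases he : s(x, y) = s(s, w)
    · have h0 : s(x, y) ∉ p.edges := by rw [he]; exact hnd.1
      rcases Sym2.eq_iff.1 he with ⟨rfl, rfl⟩ | ⟨rfl, rfl⟩
      · exact Or.inl ⟨Walk.nil, p, by simp, by simp, by simp, h0, by simp⟩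
      · exact Or.inr ⟨Walk.nil, p, by simp, by simp, by simp, h0, by simp⟩
    · rcases ih hnd.2 (hmem.resolve_left he) with ⟨p₁, p₂, h1, h2, h3, h4, h5⟩ |
        ⟨p₁, p₂, h1, h2, h3, h4, h5⟩
      · refine Or.inl ⟨Walk.cons hsw p₁, p₂, ?_, ?_, ?_, h4, ?_⟩
        · simp only [Walk.edges_cons]; exact List.cons_subset_cons _ h1
        · simp only [Walk.edges_cons]; exact List.subset_cons_of_subset _ h2
        · simp only [Walk.edges_cons, List.mem_cons, not_or]; exact ⟨he, h3⟩
        · simp only [Walk.length_cons]; omega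
      · refine Or.inr ⟨Walk.cons hsw p₁, p₂, ?_, ?_, ?_, h4, ?_⟩
        · simp only [Walk.edges_cons]; exact List.cons_subset_cons _ h1
        · simp only [Walk.edges_cons]; exact List.subset_cons_of_subset _ h2
        · simp only [Walk.edges_cons, List.mem_cons, not_or]; exact ⟨he, h3⟩
        · simp only [Walk.length_cons]; omega

/-- A walk joining the ends of an edge and avoiding it bounds the girth. -/
lemma girth_le_of_walk {G : SimpleGraph V} {x y : V} (h : G.Adj x y) (p : G.Walk x y)
    (hp : s(x, y) ∉ p.edges) {g : ℕ} (hg : (g : ℕ∞) ≤ G.egirth) : g ≤ p.length + 1 := by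
  classical
  have hc : (Walk.cons h.symm p.bypass).IsCycle := by
    rw [Walk.cons_isCycle_iff]
    refine ⟨p.bypass_isPath, fun hh => hp ?_⟩
    rw [Sym2.eq_swap]
    exact p.edges_bypass_subset_edges hh
  have h1 := hg.trans (egirth_le_length hc)
  have h2 := p.length_bypass_le_length
  rw [Walk.length_cons] at h1
  have h3 : g ≤ p.bypass.length + 1 := by exact_mod_cast h1
  omega

/-- Removing an edge from a cycle (repeated-edge-free version). -/
lemma cycle_split {G : SimpleGraph V} {x y z : V} (c : G.Walk z z) (hc : c.IsCycle)
    (h : s(x, y) ∈ c.edges) :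
    ∃ q : G.Walk x y, q.IsPath ∧ s(x, y) ∉ q.edges ∧ q.length + 1 ≤ c.length ∧
      q.edges ⊆ c.edges := by
  classical
  rcases trail_split c hc.edges_nodup h with ⟨p₁, p₂, h1, h2, h3, h4, h5⟩ |
        ⟨p₁, p₂, h1, h2, h3, h4, h5⟩
  · have hs := (p₂.append p₁).reverse.edges_bypass_subset_edges
    have hl := (p₂.append p₁).reverse.length_bypass_le_length
    refine ⟨(p₂.append p₁).reverse.bypass, Walk.bypass_isPath _, fun hh => ?_, ?_, fun e hh => ?_⟩
    · have := hs hh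
      simp [h3, h4] at this
    · rw [Walk.length_reverse, Walk.length_append] at hl; omega
    · have := hs hh
      simp at this
      grind
  · have hs := (p₂.append p₁).edges_bypass_subset_edges
    have hl := (p₂.append p₁).length_bypass_le_length
    refine ⟨(p₂.append p₁).bypass, Walk.bypass_isPath _, fun hh => ?_, ?_, fun e hh => ?_⟩
    · have := hs hh
      simp [h3, h4] at this
    · simp at hl; omega
    · have := hs hh
      simp at this
      grind

/-- The switched graph. -/
def switch (G : SimpleGraph V) (a b c d : V) : SimpleGraph V :=
  SimpleGraph.fromEdgeSet ((G.edgeSet \ {s(a, b), s(c, d)}) ∪ {s(a, c), s(b, d)})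

lemma switch_adj {G : SimpleGraph V} {a b c d : V} (hac : a ≠ c) (hbd : b ≠ d) (x y : V) :
    (switch G a b c d).Adj x y ↔
      ((G.Adj x y ∧ s(x, y) ≠ s(a, b) ∧ s(x, y) ≠ s(c, d)) ∨ s(x, y) = s(a, c) ∨
        s(x, y) = s(b, d)) := by
  unfold switch
  rw [fromEdgeSet_adj]
  simp only [Set.mem_union, Set.mem_sdiff, mem_edgeSet, Set.mem_insert_iff, Set.mem_singleton_iff,
    not_or]
  constructor
  · rintro ⟨h, -⟩; exact h
  · intro h
    refine ⟨h, ?_⟩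
    rintro rfl
    rcases h with ⟨h, -⟩ | h | h
    · exact h.ne rfl
    · rcases Sym2.eq_iff.1 h with ⟨h1, h2⟩ | ⟨h1, h2⟩
      · exact hac (h1.symm.trans h2)
      · exact hac (h2.symm.trans h1)
    · rcases Sym2.eq_iff.1 h with ⟨h1, h2⟩ | ⟨h1, h2⟩
      · exact hbd (h1.symm.trans h2)
      · exact hbd (h2.symm.trans h1)

lemma switch_ncard {G : SimpleGraph V} {a b c d : V} (hab : G.Adj a b)
    (hbc : G.Adj b c) (hcd : G.Adj c d) (hac : a ≠ c) (hbd : b ≠ d) (had : a ≠ d)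
    (nac : ¬ G.Adj a c) (nbd : ¬ G.Adj b d) (x : V) :
    ((switch G a b c d).neighborSet x).ncard = (G.neighborSet x).ncard := by
  have h1 := hab.ne
  have h2 := hbc.ne
  have h3 := hcd.ne
  by_cases ha : x = a
  · subst ha
    rw [← Set.ncard_exchange (s := G.neighborSet x) (a := c) (b := b) nac hab]
    congr 1
    ext y
    simp only [mem_neighborSet, switch_adj hac hbd, Set.mem_insert_iff, Set.mem_sdiff,
      Set.mem_singleton_iff, Sym2.eq_iff, Ne]
    grind
  by_cases hb : x = b
  · subst hb
    rw [← Set.ncard_exchange (s := G.neighborSet x) (a := d) (b := a) nbd hab.symm]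
    congr 1
    ext y
    simp only [mem_neighborSet, switch_adj hac hbd, Set.mem_insert_iff, Set.mem_sdiff,
      Set.mem_singleton_iff, Sym2.eq_iff, Ne]
    grind
  by_cases hc : x = c
  · subst hc
    rw [← Set.ncard_exchange (s := G.neighborSet x) (a := a) (b := d) (fun h => nac h.symm) hcd]
    congr 1
    ext y
    simp only [mem_neighborSet, switch_adj hac hbd, Set.mem_insert_iff, Set.mem_sdiff,
      Set.mem_singleton_iff, Sym2.eq_iff, Ne]
    grind
  by_cases hd : x = d
  · subst hd
    rw [← Set.ncard_exchange (s := G.neighborSet x) (a := b) (b := c) (fun h => nbd h.symm)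
      hcd.symm]
    congr 1
    ext y
    simp only [mem_neighborSet, switch_adj hac hbd, Set.mem_insert_iff, Set.mem_sdiff,
      Set.mem_singleton_iff, Sym2.eq_iff, Ne]
    grind
  congr 1
  ext y
  simp only [mem_neighborSet, switch_adj hac hbd, Sym2.eq_iff, Ne]
  grind

/-- Walks of the switched graph avoiding both new edges come from `G`. -/
lemma switch_lift {G : SimpleGraph V} {a b c d : V} (hac : a ≠ c) (hbd : b ≠ d) {x y : V}
    (p : (switch G a b c d).Walk x y) (h1 : s(a, c) ∉ p.edges) (h2 : s(b, d) ∉ p.edges) :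
    ∃ q : G.Walk x y, q.length = p.length ∧ s(a, b) ∉ q.edges ∧ s(c, d) ∉ q.edges := by
  have key : ∀ e ∈ p.edges, e ∈ G.edgeSet ∧ e ≠ s(a, b) ∧ e ≠ s(c, d) := by
    intro e
    induction e using Sym2.ind with
    | _ u v =>
      intro he
      have := (switch_adj hac hbd u v).1 (p.adj_of_mem_edges he)
      rcases this with h | h | h
      · exact h
      · rw [h] at he; exact absurd he h1
      · rw [h] at he; exact absurd he h2
  refine ⟨p.transfer G fun e he => (key e he).1, by simp, ?_, ?_⟩
  · rw [Walk.edges_transfer]; exact fun h => (key _ h).2.1 rfl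
  · rw [Walk.edges_transfer]; exact fun h => (key _ h).2.2 rfl

lemma switch_girth_ge {G : SimpleGraph V} {a b c d : V} {k : ℕ} (hab : G.Adj a b)
    (hbc : G.Adj b c) (hcd : G.Adj c d) (hac : a ≠ c) (hbd : b ≠ d)
    (hg : ((k + 1 : ℕ) : ℕ∞) ≤ G.egirth) :
    (k : ℕ∞) ≤ (switch G a b c d).egirth := by
  rw [le_egirth]
  intro z w hw
  have h1 := hab.ne
  have h2 := hbc.ne
  have h3 := hcd.ne
  suffices k ≤ w.length by exact_mod_cast this
  by_cases e1 : s(a, c) ∈ w.edges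
  · obtain ⟨q, hq, hq1, hq2, hq3⟩ := cycle_split w hw e1
    by_cases e2 : s(b, d) ∈ q.edges
    · rcases trail_split q hq.isTrail.edges_nodup e2 with ⟨p₁, p₂, i1, i2, i3, i4, i5⟩ |
        ⟨p₁, p₂, i1, i2, i3, i4, i5⟩
      · obtain ⟨q', hl, ha, hb⟩ := switch_lift hac hbd p₁ (fun h => hq1 (i1 h)) i3
        have := girth_le_of_walk hab q' ha hg
        omega
      · obtain ⟨q', hl, ha, hb⟩ := switch_lift hac hbd p₁ (fun h => hq1 (i1 h)) i3
        have := girth_le_of_walk hab (q'.append (.cons hcd.symm (.cons hbc.symm .nil)))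
          (by simp [ha]; grind) hg
        simp at this
        have hp2 : 0 < p₂.length := by
          rcases Nat.eq_zero_or_pos p₂.length with h | h
          · exact absurd (Walk.eq_of_length_eq_zero h) h2
          · exact h
        omega
    · obtain ⟨q', hl, ha, hb⟩ := switch_lift hac hbd q hq1 e2
      have := girth_le_of_walk hab (q'.append (.cons hbc.symm .nil)) (by simp [ha]; grind) hg
      simp at this
      omega
  · by_cases e2 : s(b, d) ∈ w.edges
    · obtain ⟨q, hq, hq1, hq2, hq3⟩ := cycle_split w hw e2
      obtain ⟨q', hl, ha, hb⟩ := switch_lift hac hbd q (fun h => e1 (hq3 h)) hq1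
      have := girth_le_of_walk hcd (.cons hbc.symm q') (by simp [hb]; grind) hg
      simp at this
      omega
    · have key : ∀ e ∈ w.edges, e ∈ G.edgeSet := by
        intro e
        induction e using Sym2.ind with
        | _ u v =>
          intro he
          rcases (switch_adj hac hbd u v).1 (w.adj_of_mem_edges he) with h | h | h
          · exact h.1
          · rw [h] at he; exact absurd he e1
          · rw [h] at he; exact absurd he e2
      have := hg.trans (egirth_le_length (hw.transfer key))
      rw [Walk.length_transfer] at this
      have : k + 1 ≤ w.length := by exact_mod_cast this
      omega

lemma switch_girth_le {G : SimpleGraph V} {a b c d : V} {k : ℕ}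
    (hac : a ≠ c) (hbd : b ≠ d) (nac : ¬ G.Adj a c)
    (R : G.Walk a c) (h1 : s(a, b) ∉ R.edges) (h2 : s(c, d) ∉ R.edges) (hR : R.length + 1 ≤ k) :
    (switch G a b c d).egirth ≤ k := by
  have key : ∀ e ∈ R.edges, e ∈ (switch G a b c d).edgeSet := by
    intro e
    induction e using Sym2.ind with
    | _ u v =>
      intro he
      rw [mem_edgeSet, switch_adj hac hbd]
      refine Or.inl ⟨R.adj_of_mem_edges he, ?_, ?_⟩
      · intro h; rw [h] at he; exact h1 he
      · intro h; rw [h] at he; exact h2 he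
  by_contra hlt
  rw [not_le] at hlt
  have hge : ((k + 1 : ℕ) : ℕ∞) ≤ (switch G a b c d).egirth := by
    push_cast
    exact Order.add_one_le_of_lt hlt
  have hadj : (switch G a b c d).Adj a c := by rw [switch_adj hac hbd]; simp
  have := girth_le_of_walk hadj (R.transfer _ key)
    (by rw [Walk.edges_transfer]; exact fun h => nac (R.adj_of_mem_edges h)) hge
  simp at this
  omega

/-- Deleting `b` and joining `a` to `c`. -/
def suppr (G : SimpleGraph V) (a b c : V) : SimpleGraph V :=
  SimpleGraph.fromEdgeSet ({e | e ∈ G.edgeSet ∧ b ∉ e} ∪ {s(a, c)})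

lemma suppr_adj {G : SimpleGraph V} {a b c : V} (hac : a ≠ c) (x y : V) :
    (suppr G a b c).Adj x y ↔ ((G.Adj x y ∧ b ∉ s(x, y)) ∨ s(x, y) = s(a, c)) := by
  unfold suppr
  rw [fromEdgeSet_adj]
  simp only [Set.mem_union, Set.mem_ofPred_eq, mem_edgeSet, Set.mem_singleton_iff]
  constructor
  · rintro ⟨h, -⟩; exact h
  · intro h
    refine ⟨h, ?_⟩
    rintro rfl
    rcases h with ⟨h, -⟩ | h
    · exact h.ne rfl
    · rcases Sym2.eq_iff.1 h with ⟨h1, h2⟩ | ⟨h1, h2⟩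
      · exact hac (h1.symm.trans h2)
      · exact hac (h2.symm.trans h1)

lemma suppr_girth_ge {G : SimpleGraph V} {a b c : V} {k : ℕ} (hab : G.Adj a b)
    (hbc : G.Adj b c) (hac : a ≠ c) (hg : ((k + 1 : ℕ) : ℕ∞) ≤ G.egirth) :
    (k : ℕ∞) ≤ (suppr G a b c).egirth := by
  rw [le_egirth]
  intro z w hw
  suffices k ≤ w.length by exact_mod_cast this
  have key : ∀ {x y : V} (p : (suppr G a b c).Walk x y), s(a, c) ∉ p.edges →
      ∀ e ∈ p.edges, e ∈ G.edgeSet ∧ b ∉ e := by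
    intro x y p hp e
    induction e using Sym2.ind with
    | _ u v =>
      intro he
      rcases (suppr_adj hac u v).1 (p.adj_of_mem_edges he) with h | h
      · exact h
      · rw [h] at he; exact absurd he hp
  by_cases e1 : s(a, c) ∈ w.edges
  · obtain ⟨q, hq, hq1, hq2, hq3⟩ := cycle_split w hw e1
    have hk := key q hq1
    have := girth_le_of_walk hab ((q.transfer G fun e he => (hk e he).1).append
      (.cons hbc.symm .nil)) (by
        rw [Walk.edges_append, Walk.edges_transfer]
        simp only [Walk.edges_cons, Walk.edges_nil, List.mem_append, List.mem_singleton, not_or]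
        exact ⟨fun h => (hk _ h).2 (by simp), by have := hab.ne; grind⟩) hg
    simp at this
    omega
  · have hk := key w e1
    have := hg.trans (egirth_le_length (hw.transfer fun e he => (hk e he).1))
    rw [Walk.length_transfer] at this
    have : k + 1 ≤ w.length := by exact_mod_cast this
    omega

lemma suppr_induce_girth_ge {G : SimpleGraph V} {a b c : V} {k : ℕ} (hab : G.Adj a b)
    (hbc : G.Adj b c) (hac : a ≠ c) (hg : ((k + 1 : ℕ) : ℕ∞) ≤ G.egirth) :
    (k : ℕ∞) ≤ ((suppr G a b c).induce {b}ᶜ).egirth :=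
  (suppr_girth_ge hab hbc hac hg).trans (IsContained.egirth_le ⟨Copy.induce _ _⟩)

lemma suppr_induce_girth_le {G : SimpleGraph V} {a b c : V} {k : ℕ} (hab : G.Adj a b)
    (hbc : G.Adj b c) (hac : a ≠ c) (nac : ¬ G.Adj a c)
    (R : G.Walk a c) (hb : b ∉ R.support) (hR : R.length + 1 ≤ k) :
    ((suppr G a b c).induce {b}ᶜ).egirth ≤ k := by
  have key : ∀ e ∈ R.edges, e ∈ (suppr G a b c).edgeSet := by
    intro e
    induction e using Sym2.ind with
    | _ u v =>
      intro he
      rw [mem_edgeSet, suppr_adj hac]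
      refine Or.inl ⟨R.adj_of_mem_edges he, ?_⟩
      intro h
      rcases Sym2.mem_iff.1 h with rfl | rfl
      · exact hb (R.fst_mem_support_of_mem_edges he)
      · exact hb (R.snd_mem_support_of_mem_edges he)
  have hs : ∀ x ∈ (R.transfer _ key).support, x ∈ ({b}ᶜ : Set V) := by
    intro x hx
    rw [Walk.support_transfer] at hx
    simp only [Set.mem_compl_iff, Set.mem_singleton_iff]
    rintro rfl
    exact hb hx
  by_contra hlt
  rw [not_le] at hlt
  have hge : ((k + 1 : ℕ) : ℕ∞) ≤ ((suppr G a b c).induce {b}ᶜ).egirth := by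
    push_cast
    exact Order.add_one_le_of_lt hlt
  have hadj : ((suppr G a b c).induce {b}ᶜ).Adj ⟨a, hab.ne⟩ ⟨c, hbc.ne.symm⟩ := by
    rw [comap_adj]
    change (suppr G a b c).Adj a c
    rw [suppr_adj hac]; simp
  have hm := Walk.map_induce (R.transfer _ key) hs
  have hl : ((R.transfer _ key).induce _ hs).length = R.length := by
    have := congrArg Walk.length hm
    rw [Walk.length_map] at this
    simpa using this
  have := girth_le_of_walk hadj ((R.transfer _ key).induce _ hs)
    (by
      intro h
      have h2 := congrArg Walk.edges hm
      rw [Walk.edges_map] at h2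
      replace h2 := h2.trans (Walk.edges_transfer R key)
      apply nac
      apply R.adj_of_mem_edges
      rw [← h2, List.mem_map]
      exact ⟨_, h, rfl⟩) hge
  omega

lemma suppr_ncard {G : SimpleGraph V} {a b c : V} (hab : G.Adj a b)
    (hbc : G.Adj b c) (hac : a ≠ c) (nac : ¬ G.Adj a c)
    (hN : ∀ y, G.Adj b y → y = a ∨ y = c) (x : V) (hx : x ∈ ({b}ᶜ : Set V)) :
    (((suppr G a b c).induce {b}ᶜ).neighborSet ⟨x, hx⟩).ncard = (G.neighborSet x).ncard := by
  have h1 := hab.ne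
  have h2 := hbc.ne
  have hx' : x ≠ b := hx
  rw [← Set.ncard_image_of_injective _ Subtype.val_injective]
  have himg : (Subtype.val '' (((suppr G a b c).induce {b}ᶜ).neighborSet ⟨x, hx⟩) : Set V) =
      {y | (G.Adj x y ∧ y ≠ b) ∨ s(x, y) = s(a, c)} := by
    ext y
    simp only [Set.mem_image, mem_neighborSet, comap_adj, Function.Embedding.subtype_apply,
      suppr_adj hac, Set.mem_ofPred_eq, Subtype.exists, Sym2.mem_iff, Sym2.eq_iff]
    constructor
    · rintro ⟨z, hz, h, rfl⟩
      grind
    · intro h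
      have hy : y ≠ b := by grind
      exact ⟨y, hy, by grind, rfl⟩
  rw [himg]
  by_cases ha : x = a
  · subst ha
    rw [← Set.ncard_exchange (s := G.neighborSet x) (a := c) (b := b) nac hab]
    congr 1
    ext y
    simp only [mem_neighborSet, Set.mem_insert_iff, Set.mem_sdiff, Set.mem_ofPred_eq,
      Set.mem_singleton_iff, Sym2.eq_iff, Ne]
    grind
  by_cases hc : x = c
  · subst hc
    rw [← Set.ncard_exchange (s := G.neighborSet x) (a := a) (b := b) (fun h => nac h.symm)
      hbc.symm]
    congr 1
    ext y
    simp only [mem_neighborSet, Set.mem_insert_iff, Set.mem_sdiff, Set.mem_ofPred_eq,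
      Set.mem_singleton_iff, Sym2.eq_iff, Ne]
    grind
  congr 1
  ext y
  simp only [mem_neighborSet, Set.mem_ofPred_eq, Sym2.eq_iff]
  have : G.Adj x y → y ≠ b := by
    rintro h rfl
    rcases hN x h.symm with h | h
    · exact ha h
    · exact hc h
  grind

/-- Decomposition of a cycle of length at least three at a given vertex. -/
lemma cycle_decomp {G : SimpleGraph V} {z c : V} (w : G.Walk z z) (hw : w.IsCycle)
    (hc : c ∈ w.support) :
    ∃ (b a : V) (_ : G.Adj c b) (_ : G.Adj b a) (R : G.Walk a c), R.length + 2 = w.length ∧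
      b ∉ R.support ∧ a ≠ c ∧ b ∈ w.support ∧ R.edges ⊆ w.edges ∧ s(c, b) ∈ w.edges := by
  classical
  have hw' := hw.rotate hc
  have hl := Walk.length_rotate w c hc
  have he := (Walk.rotate_edges w c hc).perm
  generalize w.rotate c hc = w' at hw' hl he
  have h3 := hw'.three_le_length
  cases w' with
  | nil => simp at h3
  | @cons _ b _ hcb p =>
    cases p with
    | nil => simp at h3
    | @cons _ a _ hba R =>
      rw [Walk.cons_isCycle_iff, Walk.cons_isPath_iff] at hw'
      have hcb' : s(c, b) ∈ w.edges := he.subset (by simp)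
      refine ⟨b, a, hcb, hba, R, by simpa using hl, hw'.1.2, ?_, 
        w.snd_mem_support_of_mem_edges hcb', ?_, hcb'⟩
      · rintro rfl
        apply hw'.2
        simp [Sym2.eq_swap]
      · intro e h
        exact he.subset (by simp [h])

lemma step {V : Type} [Finite V] {r m k : ℕ} (hr : 2 ≤ r) (hrm : r < m) (hk : 3 ≤ k)
    (G : SimpleGraph V) (hG : IsBiregGirthGraph r m (k + 1) G) :
    ∃ (W : Type) (_ : Finite W) (H : SimpleGraph W),
      IsBiregGirthGraph r m k H ∧ Nat.card W ≤ Nat.card V := by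
  obtain ⟨hg, hdeg, ⟨v₁, hv₁⟩, ⟨v₂, hv₂⟩⟩ := hG
  have hnac : ¬ G.IsAcyclic := by
    rw [← egirth_eq_top, hg]; exact ENat.natCast_ne_top _
  obtain ⟨z, w, hw, hwl⟩ := exists_egirth_eq_length.2 hnac
  have hl : w.length = k + 1 := by
    rw [hg] at hwl; exact_mod_cast hwl.symm
  have hge : ((k + 1 : ℕ) : ℕ∞) ≤ G.egirth := hg.ge
  have tri : ∀ x y t : V, G.Adj x y → G.Adj y t → ¬ G.Adj x t := by
    intro x y t h1 h2 h3
    have := girth_le_of_walk h3 (.cons h1 (.cons h2 .nil))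
      (by have := h1.ne; have := h2.ne; have := h3.ne; simp; grind) hge
    simp at this
    omega
  by_cases hex : ∃ c ∈ w.support, 3 ≤ (G.neighborSet c).ncard
  · obtain ⟨c, hc, hc3⟩ := hex
    obtain ⟨b, a, hcb, hba, R, hRl, hbR, hac, hbw, hRe, hcbe⟩ := cycle_decomp w hw hc
    have h2 := hw.ncard_neighborSet_toSubgraph_eq_two hc
    obtain ⟨d, hd, hd'⟩ := Set.exists_mem_notMem_of_ncard_lt_ncard
      (show (w.toSubgraph.neighborSet c).ncard < (G.neighborSet c).ncard by omega)
    rw [Subgraph.mem_neighborSet, Walk.adj_toSubgraph_iff_mem_edges] at hd'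
    have hbd : b ≠ d := by rintro rfl; exact hd' hcbe
    have nac : ¬ G.Adj a c := tri a b c hba.symm hcb.symm
    have nbd : ¬ G.Adj b d := tri b c d hcb.symm hd
    have had : a ≠ d := by rintro rfl; exact nac (G.adj_symm hd)
    have hn := switch_ncard hba.symm hcb.symm hd hac hbd had nac nbd
    refine ⟨V, inferInstance, switch G a b c d, ⟨le_antisymm ?_ ?_, ?_, ⟨v₁, ?_⟩, ⟨v₂, ?_⟩⟩, le_rfl⟩
    · refine switch_girth_le hac hbd nac R ?_ (fun h => hd' (hRe h)) (by omega)
      exact fun h => hbR (R.snd_mem_support_of_mem_edges h)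
    · exact switch_girth_ge hba.symm hcb.symm hd hac hbd hge
    · intro v; rw [hn]; exact hdeg v
    · rw [hn]; exact hv₁
    · rw [hn]; exact hv₂
  · push Not at hex
    have hz := w.start_mem_support
    obtain ⟨b, a, hcb, hba, R, hRl, hbR, hac, hbw, hRe, hcbe⟩ := cycle_decomp w hw hz
    have nac : ¬ G.Adj a z := tri a b z hba.symm hcb.symm
    have hb3 := hex b hbw
    have hz3 := hex z hz
    have hN : ∀ y, G.Adj b y → y = a ∨ y = z := by
      intro y hy
      by_contra hcon
      push Not at hcon
      have hsub : ({y, a, z} : Set V) ⊆ G.neighborSet b := by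
        rintro t (rfl | rfl | rfl)
        · exact hy
        · exact hba
        · exact hcb.symm
      have := Set.ncard_le_ncard hsub (Set.toFinite _)
      rw [Set.ncard_eq_three.2 ⟨y, a, z, hcon.1, hcon.2, hac, rfl⟩] at this
      omega
    have hn := suppr_ncard hba.symm hcb.symm hac nac hN
    have hzr : (G.neighborSet z).ncard = r := by
      rcases hdeg z with h | h <;> omega
    have hv₂b : v₂ ≠ b := by rintro rfl; omega
    refine ⟨({b}ᶜ : Set V), inferInstance, (suppr G a b z).induce {b}ᶜ,
      ⟨le_antisymm ?_ ?_, ?_, ⟨⟨z, hcb.ne⟩, ?_⟩, ⟨⟨v₂, hv₂b⟩, ?_⟩⟩, ?_⟩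
    · exact suppr_induce_girth_le hba.symm hcb.symm hac nac R hbR (by omega)
    · exact suppr_induce_girth_ge hba.symm hcb.symm hac hge
    · rintro ⟨v, hv⟩; rw [hn]; exact hdeg v
    · exact (hn z hcb.ne).trans hzr
    · exact (hn v₂ hv₂b).trans hv₂
    · exact Nat.card_le_card_of_injective _ Subtype.val_injective

lemma steps {r m g₁ : ℕ} (hr : 2 ≤ r) (hrm : r < m) (hg₁ : 3 ≤ g₁) (j : ℕ) :
    ∀ {V : Type} [Finite V] (G : SimpleGraph V), IsBiregGirthGraph r m (g₁ + j) G →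
    ∃ (W : Type) (_ : Finite W) (H : SimpleGraph W),
      IsBiregGirthGraph r m g₁ H ∧ Nat.card W ≤ Nat.card V := by
  induction j with
  | zero => intro V _ G hG; exact ⟨V, inferInstance, G, hG, le_rfl⟩
  | succ j ih =>
    intro V _ G hG
    obtain ⟨W, _, H, hH, hc⟩ := step hr hrm (by omega : 3 ≤ g₁ + j) G hG
    obtain ⟨W', i', H', hH', hc'⟩ := ih H hH
    exact ⟨W', i', H', hH', hc'.trans hc⟩

lemma bireg_iso {V : Type*} {W : Type*} {r m g : ℕ} {G : SimpleGraph V} {H : SimpleGraph W}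
    (f : G ≃g H) (hG : IsBiregGirthGraph r m g G) : IsBiregGirthGraph r m g H := by
  obtain ⟨hg, hdeg, ⟨v₁, hv₁⟩, ⟨v₂, hv₂⟩⟩ := hG
  have hn : ∀ v, (H.neighborSet (f v)).ncard = (G.neighborSet v).ncard := by
    intro v
    rw [← Nat.card_coe_set_eq, ← Nat.card_coe_set_eq]
    exact (Nat.card_congr (f.mapNeighborSet v)).symm
  refine ⟨by rw [← f.egirth_eq, hg], fun w => ?_, ⟨f v₁, by rw [hn, hv₁]⟩, ⟨f v₂, by rw [hn, hv₂]⟩⟩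
  have := hn (f.symm w)
  rw [f.apply_symm_apply] at this
  rw [this]
  exact hdeg _

lemma to_fin {V : Type*} [Finite V] {r m g : ℕ} {G : SimpleGraph V}
    (hG : IsBiregGirthGraph r m g G) :
    ∃ H : SimpleGraph (Fin (Nat.card V)), IsBiregGirthGraph r m g H := by
  have := Fintype.ofFinite V
  exact ⟨_, bireg_iso (G.overFinIso (Nat.card_eq_fintype_card).symm) hG⟩

end BiregMono

/-- Let `2 ≤ r < m` and `3 ≤ g₁ ≤ g₂`. If there is an `({r,m};g₂)`-graph on `n`
vertices, then there is an `({r,m};g₁)`-graph on at most `n` vertices; consequently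
`n({r,m};g₁) ≤ n({r,m};g₂)`. -/
theorem stmt_19 {V : Type*} [Fintype V] (r m g₁ g₂ n : ℕ)
    (hr : 2 ≤ r) (hrm : r < m) (hg₁ : 3 ≤ g₁) (hg : g₁ ≤ g₂)
    (G : SimpleGraph V) (hG : IsBiregGirthGraph r m g₂ G) (hcard : Fintype.card V = n) :
    (∃ (W : Type) (_ : Finite W) (H : SimpleGraph W),
      IsBiregGirthGraph r m g₁ H ∧ Nat.card W ≤ n) ∧
    nBireg r m g₁ ≤ nBireg r m g₂ := by
  have main : ∀ (W : Type) [Finite W] (H : SimpleGraph W), IsBiregGirthGraph r m g₂ H →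
      ∃ (W' : Type) (_ : Finite W') (H' : SimpleGraph W'),
        IsBiregGirthGraph r m g₁ H' ∧ Nat.card W' ≤ Nat.card W := by
    intro W _ H hH
    exact BiregMono.steps hr hrm hg₁ (g₂ - g₁) H (by rwa [Nat.add_sub_cancel' hg])
  obtain ⟨G₀, hG₀⟩ := BiregMono.to_fin hG
  constructor
  · obtain ⟨W, i, H, hH, hc⟩ := main _ G₀ hG₀
    refine ⟨W, i, H, hH, hc.trans ?_⟩
    rw [Nat.card_fin, Nat.card_eq_fintype_card, hcard]
  · have hne : {n : ℕ | ∃ G : SimpleGraph (Fin n), IsBiregGirthGraph r m g₂ G}.Nonempty :=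
      ⟨_, G₀, hG₀⟩
    obtain ⟨G₁, hG₁⟩ := Nat.sInf_mem hne
    obtain ⟨W, i, H, hH, hc⟩ := main _ G₁ hG₁
    rw [Nat.card_fin] at hc
    exact (Nat.sInf_le (BiregMono.to_fin hH)).trans hc
end
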